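/- arXiv:0706.0150 — 7 statements merged into one kernel-verified Lean document; each statement's English description precedes it below -/
import Mathlib

section
/- Comparison principle on a bounded domain: Let D ⊂ ℝ^m (m ≥ 2) be a bounded open set with smooth boundary, let a, b be continuous on the closure of D and locally Hölder continuous in D, with b ≥ 0 on D and b not identically zero on any connected component of D, and let σ > 1. Suppose u, v are positive functions, continuous on the closure of D and twice continuously differentiable in D, such that Δu + a(x)u − b(x)u^σ = 0 in D and Δv + a(x)v − b(x)v^σ ≤ 0 in D. If u ≤ v on the boundary ∂D, then u ≤ v throughout D. -/
open MeasureTheory Metric Set Filter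

/-- The Euclidean Laplacian: the sum of the unmixed second partial derivatives. -/
noncomputable def lap {m : ℕ} (u : EuclideanSpace ℝ (Fin m) → ℝ) (x : EuclideanSpace ℝ (Fin m)) : ℝ :=
  ∑ i : Fin m, fderiv ℝ (fun y => fderiv ℝ u y (EuclideanSpace.single i 1)) x (EuclideanSpace.single i 1)


/-- `f` is locally Hölder continuous with exponent `α` on `s`. -/
def LocallyHolderOn {m : ℕ} (α : ℝ) (f : EuclideanSpace ℝ (Fin m) → ℝ)
    (s : Set (EuclideanSpace ℝ (Fin m))) : Prop :=
  ∀ x ∈ s, ∃ t ∈ nhdsWithin x s, ∃ C : NNReal, HolderOnWith C α.toNNReal f t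

/-- `D` has smooth boundary: near each boundary point, `D` is the sublevel set of a smooth
function with nonvanishing differential. -/
def HasSmoothBoundary {m : ℕ} (D : Set (EuclideanSpace ℝ (Fin m))) : Prop :=
  ∀ x ∈ frontier D, ∃ (U : Set (EuclideanSpace ℝ (Fin m))) (f : EuclideanSpace ℝ (Fin m) → ℝ),
    IsOpen U ∧ x ∈ U ∧ ContDiffOn ℝ (⊤ : ℕ∞) f U ∧ (∀ y ∈ U, fderiv ℝ f y ≠ 0) ∧
    D ∩ U = {y ∈ U | f y < 0}

open Topology

lemma aux_line {m : ℕ} (F : EuclideanSpace ℝ (Fin m) → ℝ) (x : EuclideanSpace ℝ (Fin m))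
    (hF : ContDiffAt ℝ 2 F x) (hmax : IsLocalMax F x) (e : EuclideanSpace ℝ (Fin m)) :
    fderiv ℝ (fun y => fderiv ℝ F y e) x e ≤ 0 := by
  set γ : ℝ → EuclideanSpace ℝ (Fin m) := fun t => x + t • e with hγ
  have hγ0 : γ 0 = x := by simp [hγ]
  have hγd : ∀ t, HasDerivAt γ e t := by
    intro t
    have := ((hasDerivAt_id t).smul_const e).const_add x
    simpa [hγ] using this
  have hγc : ContinuousAt γ 0 := (hγd 0).continuousAt
  have hγt : Tendsto γ (𝓝 0) (𝓝 x) := by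
    have := hγc.tendsto
    rwa [hγ0] at this
  have hev : ∀ᶠ y in 𝓝 x, DifferentiableAt ℝ F y := by
    have h2 := hF.eventually (by simp)
    filter_upwards [h2] with y hy
    exact hy.differentiableAt (by norm_num)
  have hd1 : ∀ᶠ t in 𝓝 (0:ℝ), deriv (fun t => F (γ t)) t = fderiv ℝ F (γ t) e := by
    filter_upwards [hγt.eventually hev] with t ht
    exact (ht.hasFDerivAt.comp_hasDerivAt t (hγd t)).deriv
  have hG : DifferentiableAt ℝ (fun y => fderiv ℝ F y e) x := by
    have h1 : ContDiffAt ℝ 1 (fderiv ℝ F) x := hF.fderiv_right (by norm_num)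
    exact (h1.differentiableAt (by norm_num)).clm_apply (differentiableAt_const e)
  have hd2 : deriv (deriv (fun t => F (γ t))) 0 = fderiv ℝ (fun y => fderiv ℝ F y e) x e := by
    rw [Filter.EventuallyEq.deriv_eq hd1]
    have hG' : HasFDerivAt (fun y => fderiv ℝ F y e) (fderiv ℝ (fun y => fderiv ℝ F y e) x) (γ 0) := by
      rw [hγ0]; exact hG.hasFDerivAt
    exact (hG'.comp_hasDerivAt 0 (hγd 0)).deriv
  have hm1 : IsLocalMax (fun t => F (γ t)) 0 := by
    have := hγt.eventually hmax
    filter_upwards [this] with t ht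
    simpa [hγ0] using ht
  by_contra hpos
  push Not at hpos
  rw [← hd2] at hpos
  have hd0 : deriv (fun t => F (γ t)) 0 = 0 := hm1.deriv_eq_zero
  have hc : ContinuousAt (fun t => F (γ t)) 0 := by
    have : ContinuousAt F (γ 0) := by rw [hγ0]; exact hF.continuousAt
    exact this.comp hγc
  have hmin := isLocalMin_of_deriv_deriv_pos hpos hd0 hc
  have hconst : (fun t => F (γ t)) =ᶠ[𝓝 0] fun _ => F (γ 0) := by
    filter_upwards [hm1, hmin] with t h1 h2
    exact le_antisymm h1 h2
  have h3 : deriv (fun t => F (γ t)) =ᶠ[𝓝 0] deriv (fun _ => F (γ 0)) := hconst.deriv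
  have h4 := h3.deriv_eq
  rw [h4] at hpos
  simp at hpos

lemma lap_nonpos {m : ℕ} (F : EuclideanSpace ℝ (Fin m) → ℝ) (x : EuclideanSpace ℝ (Fin m))
    (hF : ContDiffAt ℝ 2 F x) (hmax : IsLocalMax F x) : lap F x ≤ 0 :=
  Finset.sum_nonpos fun _ _ => aux_line F x hF hmax _

lemma lap_add_smul {m : ℕ} (f g : EuclideanSpace ℝ (Fin m) → ℝ) (x : EuclideanSpace ℝ (Fin m))
    (c : ℝ) (hf : ContDiffAt ℝ 2 f x) (hg : ContDiffAt ℝ 2 g x) :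
    lap (fun y => f y + c * g y) x = lap f x + c * lap g x := by
  have key : ∀ f : EuclideanSpace ℝ (Fin m) → ℝ, ContDiffAt ℝ 2 f x → ∀ e,
      DifferentiableAt ℝ (fun y => fderiv ℝ f y e) x := by
    intro f hF e
    have h1 : ContDiffAt ℝ 1 (fderiv ℝ f) x := hF.fderiv_right (by norm_num)
    exact (h1.differentiableAt (by norm_num)).clm_apply (differentiableAt_const e)
  unfold lap
  rw [Finset.mul_sum, ← Finset.sum_add_distrib]
  refine Finset.sum_congr rfl fun i _ => ?_
  set e := EuclideanSpace.single i (1:ℝ)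
  have hev : (fun y => fderiv ℝ (fun y => f y + c * g y) y e) =ᶠ[𝓝 x]
      fun y => fderiv ℝ f y e + c * fderiv ℝ g y e := by
    filter_upwards [hf.eventually (by simp), hg.eventually (by simp)] with y h1 h2
    have h1 := (h1.differentiableAt (by norm_num)).hasFDerivAt
    have h2 := (h2.differentiableAt (by norm_num)).hasFDerivAt
    rw [(h1.fun_add (h2.const_mul c)).fderiv]
    simp
  rw [hev.fderiv_eq]
  rw [((key f hf e).hasFDerivAt.fun_add ((key g hg e).hasFDerivAt.const_mul c)).fderiv]
  simp

lemma lap_exp {m : ℕ} (q x : EuclideanSpace ℝ (Fin m)) (α C : ℝ) :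
    lap (fun y => Real.exp (-α * ‖y - q‖ ^ 2) - C) x =
      Real.exp (-α * ‖x - q‖ ^ 2) * (4 * α ^ 2 * ‖x - q‖ ^ 2 - 2 * α * m) := by
  have hN : ∀ y, HasFDerivAt (fun y : EuclideanSpace ℝ (Fin m) => Real.exp (-α * ‖y - q‖ ^ 2))
      (Real.exp (-α * ‖y - q‖ ^ 2) • ((-α) • ((2:ℕ) • innerSL ℝ (y - q)))) y := by
    intro y
    have h1 := ((hasFDerivAt_id y).sub_const q).norm_sq
    have h2 := (h1.const_mul (-α)).exp
    exact h2
  have h1 : ∀ i : Fin m, (fun y => fderiv ℝ (fun y => Real.exp (-α * ‖y - q‖ ^ 2) - C) y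
      (EuclideanSpace.single i 1)) =
      fun y => Real.exp (-α * ‖y - q‖ ^ 2) * (-2 * α * (y i - q i)) := by
    intro i
    funext y
    rw [((hN y).sub_const C).fderiv]
    simp [EuclideanSpace.inner_single_right]
    ring
  unfold lap
  have h2 : ∀ i : Fin m, fderiv ℝ (fun y => fderiv ℝ (fun y => Real.exp (-α * ‖y - q‖ ^ 2) - C) y
      (EuclideanSpace.single i 1)) x (EuclideanSpace.single i 1) =
      Real.exp (-α * ‖x - q‖ ^ 2) * (4 * α ^ 2 * (x i - q i) ^ 2 - 2 * α) := by
    intro i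
    rw [h1 i]
    have hp : HasFDerivAt (fun y : EuclideanSpace ℝ (Fin m) => y i)
      (EuclideanSpace.proj i : EuclideanSpace ℝ (Fin m) →L[ℝ] ℝ) x :=
      (EuclideanSpace.proj i : EuclideanSpace ℝ (Fin m) →L[ℝ] ℝ).hasFDerivAt
    rw [((hN x).fun_mul ((hp.sub_const (q i)).const_mul (-2 * α))).fderiv]
    simp [EuclideanSpace.inner_single_right]
    ring
  rw [Finset.sum_congr rfl fun i _ => h2 i, ← Finset.mul_sum, Finset.sum_sub_distrib,
    ← Finset.mul_sum]
  rw [EuclideanSpace.norm_sq_eq]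
  simp
  ring

set_option maxHeartbeats 1000000 in
lemma hopf_local {m : ℕ} (z : EuclideanSpace ℝ (Fin m) → ℝ) (p : EuclideanSpace ℝ (Fin m))
    (ρ A : ℝ) (hA : 0 ≤ A) (hz : ContDiffOn ℝ 2 z (ball p ρ))
    (hneg : ∀ x ∈ ball p ρ, z x ≤ 0) (hlap : ∀ x ∈ ball p ρ, A * z x ≤ lap z x)
    (hzp : z p = 0) : ∀ q ∈ ball p (ρ / 2), z q = 0 := by
  intro q hq
  by_contra hq0
  have hqd : dist q p < ρ / 2 := hq
  have hρ : 0 < ρ := by have := dist_nonneg (x := q) (y := p); linarith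
  have hsub : closedBall q (dist q p) ⊆ ball p ρ := by
    intro x hx
    have hx : dist x q ≤ dist q p := hx
    have := dist_triangle x q p
    show dist x p < ρ
    linarith
  have hcont := hz.continuousOn
  set M := closedBall q (dist q p) ∩ z ⁻¹' {0} with hM
  have hMc : IsCompact M := by
    apply (isCompact_closedBall q (dist q p)).of_isClosed_subset _ inter_subset_left
    exact (hcont.mono hsub).preimage_isClosed_of_isClosed isClosed_closedBall isClosed_singleton
  have hpM : p ∈ M := ⟨by simp [dist_comm], hzp⟩
  obtain ⟨y, hyM, hymin⟩ := hMc.exists_isMinOn ⟨p, hpM⟩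
    (f := fun x => dist x q) (by fun_prop)
  have hymin' : ∀ x ∈ M, dist y q ≤ dist x q := fun x hx => hymin hx
  have hyz : z y = 0 := hyM.2
  have hyB : y ∈ ball p ρ := hsub hyM.1
  set r := dist y q with hr
  have hr0 : 0 < r := by
    refine dist_pos.2 ?_
    rintro rfl
    exact hq0 hyz
  have hrle : r ≤ dist q p := hyM.1
  have hzneg : ∀ x ∈ ball q r, z x < 0 := by
    intro x hx
    have hx' : dist x q < r := hx
    have hxc : x ∈ closedBall q (dist q p) := by
      show dist x q ≤ _
      linarith
    refine lt_of_le_of_ne (hneg x (hsub hxc)) fun h => ?_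
    have := hymin' x ⟨hxc, h⟩
    linarith
  -- new centre
  set q' := q + (1/2 : ℝ) • (y - q) with hq'
  have e1 : y - q' = (1/2 : ℝ) • (y - q) := by rw [hq']; module
  have e2 : q' - q = (1/2 : ℝ) • (y - q) := by rw [hq']; module
  have hyr : ‖y - q‖ = r := by rw [hr, dist_eq_norm]
  have hn : ‖y - q'‖ = r / 2 := by
    rw [e1, norm_smul, hyr]; norm_num; ring
  have hzneg' : ∀ x, ‖x - q'‖ ≤ r / 2 → x ≠ y → z x < 0 := by
    intro x hx hxy
    apply hzneg
    have hpar := parallelogram_law_with_norm ℝ (x - q') (y - q')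
    have e3 : (x - q') + (y - q') = x - q := by rw [e1, hq']; module
    have e4 : (x - q') - (y - q') = x - y := by abel
    rw [e3, e4, hn] at hpar
    have hxyp : 0 < ‖x - y‖ := norm_pos_iff.2 (sub_ne_zero.2 hxy)
    show dist x q < r
    rw [dist_eq_norm]
    have h0 := norm_nonneg (x - q')
    refine lt_of_pow_lt_pow_left₀ 2 hr0.le ?_
    nlinarith
  -- radius
  obtain ⟨δ0, hδ0, hδsub⟩ := Metric.isOpen_iff.1 isOpen_ball y hyB
  set δ := min (δ0 / 2) (r / 4) with hδ
  have hδp : 0 < δ := by rw [hδ]; positivity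
  have hδ1 : δ ≤ δ0 / 2 := min_le_left _ _
  have hδ2 : δ ≤ r / 4 := min_le_right _ _
  have hKsub : closedBall y δ ⊆ ball p ρ :=
    (closedBall_subset_ball (by linarith)).trans hδsub
  -- barrier
  set α : ℝ := (16 * (2 * m + A + 1)) / r ^ 2 + 1 with hα
  have hα1 : 1 ≤ α := by
    have : 0 ≤ (16 * (2 * m + A + 1)) / r ^ 2 := by positivity
    linarith
  have hαr : 16 * (2 * m + A + 1) ≤ α * r ^ 2 := by
    rw [hα, add_mul, div_mul_cancel₀ _ (by positivity)]
    nlinarith [sq_nonneg r]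
  set h : EuclideanSpace ℝ (Fin m) → ℝ :=
    fun x => Real.exp (-α * ‖x - q'‖ ^ 2) - Real.exp (-α * (r / 2) ^ 2) with hh
  have hhC : ContDiff ℝ 2 h := by
    rw [hh]
    have : ContDiff ℝ 2 fun x : EuclideanSpace ℝ (Fin m) => ‖x - q'‖ ^ 2 :=
      (contDiff_id.sub contDiff_const).norm_sq ℝ
    exact ((contDiff_const.mul this).exp).sub contDiff_const
  have hhlap : ∀ x ∈ closedBall y δ, A * h x < lap h x := by
    intro x hx
    have hx' : ‖x - y‖ ≤ δ := by rw [← dist_eq_norm]; exact hx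
    have hlow : r / 4 ≤ ‖x - q'‖ := by
      have := norm_sub_le_norm_add (y - q') (x - y)
      have e5 : (y - q') + (x - y) = x - q' := by abel
      rw [e5, hn] at this
      linarith
    have hs : r ^ 2 / 16 ≤ ‖x - q'‖ ^ 2 := by nlinarith
    rw [hh, lap_exp]
    have hE := Real.exp_pos (-α * ‖x - q'‖ ^ 2)
    have hE' := Real.exp_pos (-α * (r / 2) ^ 2)
    set E := Real.exp (-α * ‖x - q'‖ ^ 2)
    have hm0 : (0:ℝ) ≤ m := Nat.cast_nonneg m
    have h1 : (2 * m + A + 1) ≤ α * ‖x - q'‖ ^ 2 := by nlinarith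
    have h2 : α * (2 * m + A + 1) ≤ α ^ 2 * ‖x - q'‖ ^ 2 := by nlinarith
    have h3 : A < 4 * α ^ 2 * ‖x - q'‖ ^ 2 - 2 * α * m := by nlinarith [mul_nonneg (sub_nonneg.2 hα1) hA, mul_nonneg (sub_nonneg.2 hα1) hm0]
    have h4 := mul_lt_mul_of_pos_left h3 hE
    have h5 := mul_nonneg hA hE'.le
    show A * (E - _) < _
    rw [mul_sub, mul_comm A E]
    exact lt_of_le_of_lt (by linarith) h4
  have hhle : ∀ x, h x ≤ 1 := by
    intro x
    have h1 : Real.exp (-α * ‖x - q'‖ ^ 2) ≤ 1 := by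
      rw [Real.exp_le_one_iff]
      have := mul_nonneg (by linarith : 0 ≤ α) (sq_nonneg ‖x - q'‖)
      linarith
    have hE' := Real.exp_pos (-α * (r / 2) ^ 2)
    show _ - _ ≤ _
    linarith
  have hhneg : ∀ x, r / 2 < ‖x - q'‖ → h x < 0 := by
    intro x hx
    show _ - _ < (0:ℝ)
    rw [sub_neg, Real.exp_lt_exp]
    have : (r / 2) ^ 2 < ‖x - q'‖ ^ 2 := by gcongr
    nlinarith
  have hhy : h y = 0 := by
    show _ - _ = (0:ℝ)
    rw [hn]; ring
  -- compactness bound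
  set S := sphere y δ ∩ closedBall q' (r / 2) with hS
  have hSneg : ∀ x ∈ S, z x < 0 := by
    rintro x ⟨hx1, hx2⟩
    apply hzneg' x
    · rw [← dist_eq_norm]; exact hx2
    · rintro rfl
      simp at hx1
      exact hδp.ne hx1
  obtain ⟨η, hη, hSη⟩ : ∃ η > 0, ∀ x ∈ S, z x ≤ -η := by
    have hSc : IsCompact S := (isCompact_sphere y δ).inter_right isClosed_closedBall
    rcases S.eq_empty_or_nonempty with he | hne
    · exact ⟨1, one_pos, by simp [he]⟩
    · obtain ⟨s, hs, hsmax⟩ := hSc.exists_isMaxOn hne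
        (hcont.mono ((inter_subset_left.trans sphere_subset_closedBall).trans hKsub))
      exact ⟨-z s, by have := hSneg s hs; linarith, fun x hx => by
        have : z x ≤ z s := hsmax hx
        linarith⟩
  set ε := η / 2 with hε
  have hεp : 0 < ε := by positivity
  have hFc : ContinuousOn (fun x => z x + ε * h x) (closedBall y δ) :=
    (hcont.mono hKsub).add (continuousOn_const.mul hhC.continuous.continuousOn)
  obtain ⟨x0, hx0, hx0max⟩ := (isCompact_closedBall y δ).exists_isMaxOn
    ⟨y, mem_closedBall_self hδp.le⟩ hFc
  have hF0 : 0 ≤ z x0 + ε * h x0 := by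
    have : z y + ε * h y ≤ z x0 + ε * h x0 := hx0max (mem_closedBall_self hδp.le)
    rw [hyz, hhy] at this
    linarith
  have hx0B : x0 ∈ ball y δ := by
    by_contra hnot
    have hsph : x0 ∈ sphere y δ := by
      have h1 : dist x0 y ≤ δ := hx0
      have h2 : ¬ dist x0 y < δ := hnot
      exact le_antisymm h1 (not_lt.1 h2)
    by_cases hc : ‖x0 - q'‖ ≤ r / 2
    · have h1 := hSη x0 ⟨hsph, by rw [mem_closedBall, dist_eq_norm]; exact hc⟩
      have h2 := hhle x0
      nlinarith
    · have h1 := hhneg x0 (not_le.1 hc)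
      have h2 := hneg x0 (hKsub hx0)
      nlinarith
  have hlm : IsLocalMax (fun x => z x + ε * h x) x0 :=
    hx0max.isLocalMax (closedBall_mem_nhds_of_mem hx0B)
  have hzx : ContDiffAt ℝ 2 z x0 := hz.contDiffAt (isOpen_ball.mem_nhds (hKsub hx0))
  have hfin := lap_nonpos _ x0 (hzx.add (contDiffAt_const.mul hhC.contDiffAt)) hlm
  rw [lap_add_smul z h x0 ε hzx hhC.contDiffAt] at hfin
  have h1 := hlap x0 (hKsub hx0)
  have h2 := mul_lt_mul_of_pos_left (hhlap x0 hx0) hεp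
  have h3 := mul_nonneg hA hF0
  nlinarith

/-- comparison principle on a bounded domain with smooth boundary. -/
theorem stmt_0 {m : ℕ} (hm : 2 ≤ m) (D : Set (EuclideanSpace ℝ (Fin m)))
    (hDopen : IsOpen D) (hDbdd : Bornology.IsBounded D) (hDsmooth : HasSmoothBoundary D)
    (a b : EuclideanSpace ℝ (Fin m) → ℝ) (α : ℝ) (hα : α ∈ Set.Ioo (0:ℝ) 1)
    (ha : ContinuousOn a (closure D)) (hb : ContinuousOn b (closure D))
    (haH : LocallyHolderOn α a D) (hbH : LocallyHolderOn α b D)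
    (hbnn : ∀ x ∈ D, 0 ≤ b x)
    (hbne : ∀ x ∈ D, ∃ y ∈ connectedComponentIn D x, b y ≠ 0)
    (σ : ℝ) (hσ : 1 < σ)
    (u v : EuclideanSpace ℝ (Fin m) → ℝ)
    (hucont : ContinuousOn u (closure D)) (hvcont : ContinuousOn v (closure D))
    (huC2 : ContDiffOn ℝ 2 u D) (hvC2 : ContDiffOn ℝ 2 v D)
    (hupos : ∀ x ∈ closure D, 0 < u x) (hvpos : ∀ x ∈ closure D, 0 < v x)
    (hueq : ∀ x ∈ D, lap u x + a x * u x - b x * u x ^ σ = 0)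
    (hvineq : ∀ x ∈ D, lap v x + a x * v x - b x * v x ^ σ ≤ 0)
    (hbdry : ∀ x ∈ frontier D, u x ≤ v x) :
    ∀ x ∈ D, u x ≤ v x := by
  intro x0 hx0
  by_contra hcon
  push Not at hcon
  have hDc : IsCompact (closure D) := hDbdd.isCompact_closure
  obtain ⟨p, hpcl, hpmax⟩ := hDc.exists_isMaxOn ⟨x0, subset_closure hx0⟩
    (hucont.div hvcont fun x hx => (hvpos x hx).ne')
  have hpmax' : ∀ x ∈ closure D, u x / v x ≤ u p / v p := fun x hx => hpmax hx
  set k := u p / v p with hk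
  have hk1 : 1 < k := by
    have h1 := hpmax' x0 (subset_closure hx0)
    have h2 : 1 < u x0 / v x0 := (one_lt_div (hvpos x0 (subset_closure hx0))).2 hcon
    linarith
  have hle : ∀ x ∈ closure D, u x ≤ k * v x := fun x hx =>
    (div_le_iff₀ (hvpos x hx)).1 (hpmax' x hx)
  have hpeq : u p = k * v p := by rw [hk, div_mul_cancel₀ _ (hvpos p hpcl).ne']
  have hpD : p ∈ D := by
    by_contra hpn
    have hf : p ∈ frontier D := by
      rw [hDopen.frontier_eq]; exact ⟨hpcl, hpn⟩
    have := hbdry p hf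
    have := hvpos p hpcl
    nlinarith
  set z : EuclideanSpace ℝ (Fin m) → ℝ := fun x => u x + (-k) * v x with hz
  have hzC : ContDiffOn ℝ 2 z D := huC2.add (contDiffOn_const.mul hvC2)
  have hzneg : ∀ x ∈ D, z x ≤ 0 := fun x hx => by
    have := hle x (subset_closure hx)
    show u x + (-k) * v x ≤ 0
    linarith
  have hzlap : ∀ x ∈ D, b x * (u x ^ σ - k * v x ^ σ) - a x * z x ≤ lap z x := by
    intro x hx
    rw [hz, lap_add_smul u v x (-k) (huC2.contDiffAt (hDopen.mem_nhds hx))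
      (hvC2.contDiffAt (hDopen.mem_nhds hx))]
    have h1 := hueq x hx
    have h2 := hvineq x hx
    have h3 := mul_le_mul_of_nonneg_left h2 (by linarith : 0 ≤ k)
    show b x * (u x ^ σ - k * v x ^ σ) - a x * (u x + (-k) * v x) ≤ _
    nlinarith
  have hkσ : ∀ x ∈ D, z x = 0 → 0 < u x ^ σ - k * v x ^ σ := by
    intro x hx h0
    have hux : u x = k * v x := by
      have : u x + (-k) * v x = 0 := h0
      linarith
    have hv := hvpos x (subset_closure hx)
    rw [hux, Real.mul_rpow (by linarith) hv.le, ← sub_mul]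
    have h1 : k < k ^ σ := by
      nth_rewrite 1 [← Real.rpow_one k]
      exact Real.rpow_lt_rpow_of_exponent_lt hk1 hσ
    exact mul_pos (by linarith) (Real.rpow_pos_of_pos hv σ)
  obtain ⟨A, hAb⟩ := hDc.exists_bound_of_continuousOn ha
  have hA0 : 0 ≤ A := (norm_nonneg _).trans (hAb p hpcl)
  -- the contact set is open
  have hopen : ∀ y ∈ D, z y = 0 → ∀ᶠ x in nhds y, z x = 0 := by
    intro y hy h0
    have hucy : ContinuousAt u y := (huC2.continuousOn).continuousAt (hDopen.mem_nhds hy)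
    have hvcy : ContinuousAt v y := (hvC2.continuousOn).continuousAt (hDopen.mem_nhds hy)
    have hgc : ContinuousAt (fun x => u x ^ σ - k * v x ^ σ) y :=
      (hucy.rpow_const (Or.inr (by linarith))).sub
        (continuousAt_const.mul (hvcy.rpow_const (Or.inr (by linarith))))
    have hev := (hgc.eventually (lt_mem_nhds (hkσ y hy h0))).and (hDopen.mem_nhds hy)
    obtain ⟨ρ, hρ, hball⟩ := Metric.eventually_nhds_iff_ball.1 hev
    have := hopf_local z y ρ A hA0 (hzC.mono fun x hx => (hball x hx).2)
      (fun x hx => hzneg x (hball x hx).2) (fun x hx => by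
        obtain ⟨hg, hxD⟩ := hball x hx
        have h1 := hzlap x hxD
        have h2 := mul_nonneg (hbnn x hxD) hg.le
        have h3 := hAb x (subset_closure hxD)
        rw [Real.norm_eq_abs] at h3
        have h4 := (abs_le.1 h3).1
        have h5 := hzneg x hxD
        nlinarith) h0
    exact Metric.eventually_nhds_iff_ball.2 ⟨ρ / 2, by positivity, this⟩
  obtain ⟨y, hyc, hby⟩ := hbne p hpD
  have hCD : connectedComponentIn D p ⊆ D := connectedComponentIn_subset D p
  have hU : IsOpen (D ∩ {x | z x = 0}) := by
    rw [isOpen_iff_mem_nhds]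
    rintro x ⟨hx, h0⟩
    exact Filter.inter_mem (hDopen.mem_nhds hx) (hopen x hx h0)
  have hV : IsOpen (D ∩ z ⁻¹' (Set.Iio 0)) :=
    hzC.continuousOn.isOpen_inter_preimage hDopen isOpen_Iio
  have hsub : connectedComponentIn D p ⊆ D ∩ {x | z x = 0} := by
    refine isPreconnected_connectedComponentIn.subset_left_of_subset_union hU hV ?_ ?_ ?_
    · rw [Set.disjoint_left]
      rintro x ⟨_, h1⟩ ⟨_, h2⟩
      have h1 : z x = 0 := h1
      have h2 : z x < 0 := h2
      linarith
    · intro x hx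
      rcases (hzneg x (hCD hx)).lt_or_eq with h | h
      · exact Or.inr ⟨hCD hx, h⟩
      · exact Or.inl ⟨hCD hx, h⟩
    · refine ⟨p, mem_connectedComponentIn hpD, hpD, ?_⟩
      show u p + (-k) * v p = 0
      linarith
  obtain ⟨hyD, hy0⟩ := hsub hyc
  have hy0 : z y = 0 := hy0
  have hlm : IsLocalMax z y := by
    filter_upwards [hDopen.mem_nhds hyD] with x hx
    rw [hy0]; exact hzneg x hx
  have h1 := lap_nonpos z y (hzC.contDiffAt (hDopen.mem_nhds hyD)) hlm
  have h2 := hzlap y hyD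
  rw [hy0] at h2
  have hbpos : 0 < b y := lt_of_le_of_ne (hbnn y hyD) (Ne.symm hby)
  have h3 := mul_pos hbpos (hkσ y hyD hy0)
  linarith
end

section
/- Uniqueness of solutions with a positive limit at infinity: Let a, b : ℝ^m → ℝ be continuous with b ≥ 0 and b not identically zero, let σ > 1 and L > 0. Then there is at most one positive C² function u on ℝ^m satisfying Δu + a(x)u − b(x)u^σ = 0 on ℝ^m together with u(x) → L as |x| → ∞. -/
open MeasureTheory Metric Set Filter

lemma d2_nonpos {m : ℕ} (f : EuclideanSpace ℝ (Fin m) → ℝ) (hf : ContDiff ℝ 2 f)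
    (p e : EuclideanSpace ℝ (Fin m)) (hp : IsLocalMax f p) :
    fderiv ℝ (fun y => fderiv ℝ f y e) p e ≤ 0 := by
  set g : ℝ → ℝ := fun t => f (p + t • e) with hg
  have hline : ∀ t : ℝ, HasDerivAt (fun t : ℝ => p + t • e) e t := by
    intro t
    simpa using ((hasDerivAt_id t).smul_const e).const_add p
  have hd1 : ∀ t, HasDerivAt g (fderiv ℝ f (p + t • e) e) t := by
    intro t
    exact ((hf.differentiable (by norm_num)) (p + t • e)).hasFDerivAt.comp_hasDerivAt t (hline t)
  have hdg : deriv g = fun t => fderiv ℝ f (p + t • e) e := funext fun t => (hd1 t).deriv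
  have hF : Differentiable ℝ (fun y => fderiv ℝ f y e) := by
    have h1 : ContDiff ℝ 1 (fderiv ℝ f) := hf.fderiv_right (by norm_num)
    exact (h1.differentiable (by norm_num)).clm_apply (differentiable_const e)
  have hd2 : HasDerivAt (deriv g) (fderiv ℝ (fun y => fderiv ℝ f y e) p e) 0 := by
    rw [hdg]
    have h := (hF (p + (0 : ℝ) • e)).hasFDerivAt.comp_hasDerivAt (0 : ℝ) (hline 0)
    simpa [Function.comp_def] using h
  have hmax : IsLocalMax g 0 := by
    have hc : Filter.Tendsto (fun t : ℝ => p + t • e) (nhds 0) (nhds p) := by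
      have := (hline 0).continuousAt.tendsto
      simpa using this
    have := hc.eventually hp
    simpa [IsLocalMax, IsMaxFilter, hg] using this
  by_contra hcon
  push Not at hcon
  have hmin : IsLocalMin g 0 :=
    isLocalMin_of_deriv_deriv_pos (by rw [hd2.deriv]; exact hcon) hmax.deriv_eq_zero
      (hd1 0).continuousAt
  have heq : g =ᶠ[nhds 0] fun _ => g 0 := by
    filter_upwards [hmax, hmin] with t h1 h2 using le_antisymm h1 h2
  have h0 : deriv (deriv g) 0 = 0 := by
    rw [heq.deriv.deriv_eq]; simp
  rw [hd2.deriv] at h0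
  linarith

lemma d2_sub_mul {m : ℕ} (u v h : EuclideanSpace ℝ (Fin m) → ℝ) (hu : ContDiff ℝ 2 u)
    (hv : ContDiff ℝ 2 v) (hh : ContDiff ℝ 2 h) (p e : EuclideanSpace ℝ (Fin m)) :
    fderiv ℝ (fun y => fderiv ℝ (fun z => u z - v z * h z) y e) p e =
      fderiv ℝ (fun y => fderiv ℝ u y e) p e
        - (v p * fderiv ℝ (fun y => fderiv ℝ h y e) p e
          + h p * fderiv ℝ (fun y => fderiv ℝ v y e) p e
          + 2 * (fderiv ℝ v p e * fderiv ℝ h p e)) := by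
  have hF : ∀ f : EuclideanSpace ℝ (Fin m) → ℝ, ContDiff ℝ 2 f →
      Differentiable ℝ f ∧ Differentiable ℝ (fun y => fderiv ℝ f y e) := by
    intro f hf
    have h1 : ContDiff ℝ 1 (fderiv ℝ f) := hf.fderiv_right (by norm_num)
    exact ⟨hf.differentiable (by norm_num),
      (h1.differentiable (by norm_num)).clm_apply (differentiable_const e)⟩
  obtain ⟨u1, u2⟩ := hF u hu
  obtain ⟨v1, v2⟩ := hF v hv
  obtain ⟨h1, h2⟩ := hF h hh
  have e1 : (fun y => fderiv ℝ (fun z => u z - v z * h z) y e) =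
      fun y => fderiv ℝ u y e - (v y * fderiv ℝ h y e + h y * fderiv ℝ v y e) := by
    funext y
    rw [((u1 y).hasFDerivAt.fun_sub ((v1 y).hasFDerivAt.fun_mul (h1 y).hasFDerivAt)).fderiv]
    simp
  rw [e1, ((u2 p).hasFDerivAt.fun_sub (((v1 p).hasFDerivAt.fun_mul (h2 p).hasFDerivAt).fun_add
    ((h1 p).hasFDerivAt.fun_mul (v2 p).hasFDerivAt))).fderiv]
  simp
  ring

lemma rpow_cmp {s t σ : ℝ} (hs : 0 < s) (hst : s < t) (hσ : 1 < σ) :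
    t * s ^ σ < t ^ σ * s := by
  have ht : 0 < t := hs.trans hst
  have h1 : s ^ σ = s ^ (σ - 1) * s := by
    rw [Real.rpow_sub_one hs.ne']; field_simp
  have h2 : t ^ σ = t ^ (σ - 1) * t := by
    rw [Real.rpow_sub_one ht.ne']; field_simp
  have h3 : s ^ (σ - 1) < t ^ (σ - 1) := Real.rpow_lt_rpow hs.le hst (by linarith)
  rw [h1, h2]
  nlinarith [mul_pos hs ht]

lemma sol_le {m : ℕ} (a b : EuclideanSpace ℝ (Fin m) → ℝ)
    (hbnn : ∀ x, 0 ≤ b x) (hbne : ∃ x, b x ≠ 0)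
    (σ L : ℝ) (hσ : 1 < σ) (hL : 0 < L)
    (u v : EuclideanSpace ℝ (Fin m) → ℝ)
    (huC2 : ContDiff ℝ 2 u) (hvC2 : ContDiff ℝ 2 v)
    (hupos : ∀ x, 0 < u x) (hvpos : ∀ x, 0 < v x)
    (hueq : ∀ x, lap u x + a x * u x - b x * u x ^ σ = 0)
    (hveq : ∀ x, lap v x + a x * v x - b x * v x ^ σ = 0)
    (hulim : Filter.Tendsto u (Filter.cocompact (EuclideanSpace ℝ (Fin m))) (nhds L))
    (hvlim : Filter.Tendsto v (Filter.cocompact (EuclideanSpace ℝ (Fin m))) (nhds L)) 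
    (x0 : EuclideanSpace ℝ (Fin m)) : u x0 ≤ v x0 := by
  by_contra hcon
  push Not at hcon
  rcases m with _ | k
  · obtain ⟨x, hx⟩ := hbne
    obtain rfl : x = x0 := Subsingleton.elim _ _
    have h1 := hueq x
    have h2 := hveq x
    simp only [lap, Finset.univ_eq_empty, Finset.sum_empty] at h1 h2
    have hb0 : 0 < b x := lt_of_le_of_ne (hbnn x) (Ne.symm hx)
    have := mul_lt_mul_of_pos_left (rpow_cmp (hvpos x) hcon hσ) hb0
    have h3 : b x * (u x * v x ^ σ) = b x * (u x ^ σ * v x) := by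
      linear_combination v x * h1 - u x * h2
    linarith
  · set w : EuclideanSpace ℝ (Fin (k+1)) → ℝ := fun x => u x / v x with hw
    have hwc : Continuous w := huC2.continuous.div hvC2.continuous fun x => (hvpos x).ne'
    have hwlim : Filter.Tendsto w (Filter.cocompact _) (nhds 1) := by
      have := hulim.div hvlim hL.ne'
      rwa [div_self hL.ne'] at this
    obtain ⟨c, hc1, hcM⟩ : ∃ c, 1 < c ∧ c < w x0 :=
      exists_between ((one_lt_div (hvpos x0)).2 hcon)
    set K := {x | c ≤ w x} with hK
    have hKc : IsCompact K := by
      have hev := hwlim.eventually (gt_mem_nhds hc1)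
      obtain ⟨S, hS, hSK⟩ := Filter.mem_cocompact.1 hev
      refine hS.of_isClosed_subset (isClosed_le continuous_const hwc) ?_
      intro x hx
      by_contra hxS
      have : w x < c := hSK hxS
      exact absurd hx (not_le.2 this)
    have hx0K : x0 ∈ K := hcM.le
    set e0 : EuclideanSpace ℝ (Fin (k+1)) := EuclideanSpace.single 0 1 with he0
    have hdvc : Continuous (fun y => fderiv ℝ v y e0) := by
      have h1 : ContDiff ℝ 1 (fderiv ℝ v) := hvC2.fderiv_right (by norm_num)
      exact h1.continuous.clm_apply continuous_const
    obtain ⟨l, hl0, hl⟩ : ∃ l : ℝ, 0 < l ∧ ∀ x ∈ K, 0 < 2 * fderiv ℝ v x e0 + l * v x := by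
      have hq : Continuous (fun y => 2 * fderiv ℝ v y e0 / v y) :=
        (continuous_const.mul hdvc).div hvC2.continuous fun x => (hvpos x).ne'
      obtain ⟨C, hC⟩ := hKc.exists_bound_of_continuousOn hq.continuousOn
      refine ⟨|C| + 1, by positivity, fun x hx => ?_⟩
      have h1 := hC x hx
      rw [Real.norm_eq_abs] at h1
      have h2 := neg_abs_le (2 * fderiv ℝ v x e0 / v x)
      have h3 : 0 < 2 * fderiv ℝ v x e0 / v x + (|C| + 1) := by linarith [le_abs_self C]
      have h4 := mul_pos h3 (hvpos x)
      have h5 : (2 * fderiv ℝ v x e0 / v x + (|C| + 1)) * v x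
        = 2 * fderiv ℝ v x e0 + (|C| + 1) * v x := by
        have := (hvpos x).ne'
        field_simp
      linarith
    set ψ : EuclideanSpace ℝ (Fin (k+1)) → ℝ := fun x => Real.exp (l * x 0) with hψ
    have hψC : ContDiff ℝ 2 ψ := by
      simp only [hψ]; fun_prop
    obtain ⟨B, hB⟩ := hKc.exists_bound_of_continuousOn hψC.continuous.continuousOn
    have hB0 : 0 < B := lt_of_lt_of_le (norm_pos_iff.2 (Real.exp_pos _).ne') (hB x0 hx0K)
    obtain ⟨ε, hε0, hεB⟩ : ∃ ε : ℝ, 0 < ε ∧ ε * B = w x0 - c :=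
      ⟨(w x0 - c) / B, div_pos (by linarith) hB0, by field_simp⟩
    obtain ⟨p, hpK, hpmax⟩ := hKc.exists_isMaxOn ⟨x0, hx0K⟩
      (f := fun x => w x + ε * ψ x)
      (hwc.add (continuous_const.mul hψC.continuous)).continuousOn
    have hpc : c < w p := by
      have h1 : w x0 + ε * ψ x0 ≤ w p + ε * ψ p := hpmax hx0K
      have h2 : ψ p ≤ B := (le_abs_self _).trans (hB p hpK)
      have h3 : 0 < ε * ψ x0 := mul_pos hε0 (Real.exp_pos _)
      nlinarith
    set t0 := w p + ε * ψ p with ht0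
    set h : EuclideanSpace ℝ (Fin (k+1)) → ℝ := fun x => t0 - ε * ψ x with hh
    have hhC : ContDiff ℝ 2 h := contDiff_const.sub (contDiff_const.mul hψC)
    have hhp : h p = u p / v p := by simp [hh, ht0, hw]
    have hloc : IsLocalMax (fun z => u z - v z * h z) p := by
      have hev : ∀ᶠ x in nhds p, c < w x := hwc.continuousAt.eventually (lt_mem_nhds hpc)
      filter_upwards [hev] with x hx
      have h1 : w x + ε * ψ x ≤ t0 := hpmax (show c ≤ w x from hx.le)
      have h2 : w x ≤ h x := by simp only [hh]; linarith
      have h3 : u x ≤ h x * v x := (div_le_iff₀ (hvpos x)).1 h2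
      have h4 : v p * h p = u p := by
        rw [hhp]; have := (hvpos p).ne'; field_simp
      show u x - v x * h x ≤ u p - v p * h p
      linarith
    have hfC : ContDiff ℝ 2 (fun z => u z - v z * h z) := huC2.sub (hvC2.mul hhC)
    have hdψ : ∀ y, HasFDerivAt ψ (Real.exp (l * y 0) • (l • (EuclideanSpace.proj (0 : Fin (k+1)) : EuclideanSpace ℝ (Fin (k+1)) →L[ℝ] ℝ))) y := by
      intro y
      exact (((EuclideanSpace.proj (0 : Fin (k+1)) : EuclideanSpace ℝ (Fin (k+1)) →L[ℝ] ℝ).hasFDerivAt (x := y)).const_mul l).exp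
    have hdh : ∀ y e, fderiv ℝ h y e = -(ε * l * e 0) * ψ y := by
      intro y e
      rw [((hdψ y).const_mul ε |>.const_sub t0).fderiv]
      simp [hψ]; ring
    have hd2h : ∀ y e, fderiv ℝ (fun z => fderiv ℝ h z e) y e = -(ε * l^2 * (e 0)^2) * ψ y := by
      intro y e
      have : (fun z => fderiv ℝ h z e) = fun z => -(ε * l * e 0) * ψ z := funext fun z => hdh z e
      rw [this, ((hdψ y).const_mul _).fderiv]
      simp [hψ]; ring
    have hsum : lap (fun z => u z - v z * h z) p ≤ 0 :=
      Finset.sum_nonpos fun i _ => d2_nonpos _ hfC p _ hloc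
    have hexp : lap (fun z => u z - v z * h z) p =
        lap u p - h p * lap v p + ε * l * ψ p * (2 * fderiv ℝ v p e0 + l * v p) := by
      simp only [lap, d2_sub_mul u v h huC2 hvC2 hhC, hd2h]
      simp only [hdh]
      rw [Finset.sum_sub_distrib, Finset.sum_add_distrib, Finset.sum_add_distrib,
        ← Finset.mul_sum, ← Finset.mul_sum, ← Finset.mul_sum]
      have s1 : ∑ i : Fin (k+1), -(ε * l^2 * ((EuclideanSpace.single i (1:ℝ) : EuclideanSpace ℝ (Fin (k+1))) 0)^2) * ψ p = -(ε * l^2) * ψ p := by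
        rw [Finset.sum_eq_single 0]
        · simp
        · intro i _ hi; simp [hi.symm]
        · simp
      have s2 : ∑ i : Fin (k+1), fderiv ℝ v p (EuclideanSpace.single i (1:ℝ)) * (-(ε * l * (EuclideanSpace.single i (1:ℝ) : EuclideanSpace ℝ (Fin (k+1))) 0) * ψ p) = fderiv ℝ v p e0 * (-(ε * l) * ψ p) := by
        rw [Finset.sum_eq_single 0]
        · simp [he0]
        · intro i _ hi; simp [hi.symm]
        · simp
      rw [s1, s2]
      ring
    have hpos : 0 < ε * l * ψ p * (2 * fderiv ℝ v p e0 + l * v p) :=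
      mul_pos (mul_pos (mul_pos hε0 hl0) (Real.exp_pos _)) (hl p hpK)
    have hneg : lap u p - h p * lap v p < 0 := by linarith
    have huv : v p < u p := (one_lt_div (hvpos p)).1 (hc1.trans hpc)
    have h5 := mul_le_mul_of_nonneg_left (rpow_cmp (hvpos p) huv hσ).le (hbnn p)
    have h6 : (lap u p - h p * lap v p) * v p = lap u p * v p - u p * lap v p := by
      rw [hhp]; have := (hvpos p).ne'; field_simp
    have h7 : lap u p * v p - u p * lap v p = b p * (u p ^ σ * v p) - b p * (u p * v p ^ σ) := by
      linear_combination v p * hueq p - u p * hveq p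
    have h8 := mul_neg_of_neg_of_pos hneg (hvpos p)
    linarith

/-- uniqueness of positive solutions with a positive limit at infinity. -/
theorem stmt_2 {m : ℕ} (a b : EuclideanSpace ℝ (Fin m) → ℝ)
    (ha : Continuous a) (hb : Continuous b)
    (hbnn : ∀ x, 0 ≤ b x) (hbne : ∃ x, b x ≠ 0)
    (σ L : ℝ) (hσ : 1 < σ) (hL : 0 < L)
    (u v : EuclideanSpace ℝ (Fin m) → ℝ)
    (huC2 : ContDiff ℝ 2 u) (hvC2 : ContDiff ℝ 2 v)
    (hupos : ∀ x, 0 < u x) (hvpos : ∀ x, 0 < v x)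
    (hueq : ∀ x, lap u x + a x * u x - b x * u x ^ σ = 0)
    (hveq : ∀ x, lap v x + a x * v x - b x * v x ^ σ = 0)
    (hulim : Filter.Tendsto u (Filter.cocompact (EuclideanSpace ℝ (Fin m))) (nhds L))
    (hvlim : Filter.Tendsto v (Filter.cocompact (EuclideanSpace ℝ (Fin m))) (nhds L)) :
    u = v := by
  funext x
  exact le_antisymm
    (sol_le a b hbnn hbne σ L hσ hL u v huC2 hvC2 hupos hvpos hueq hveq hulim hvlim x)
    (sol_le a b hbnn hbne σ L hσ hL v u hvC2 huC2 hvpos hupos hveq hueq hvlim hulim x)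
end

section
/- Comparison of sub- and supersolutions under a lower bound on b: Let a, b : ℝ^m → ℝ be continuous (m ≥ 2) and suppose that for some constants C > 0 and 0 ≤ μ < 2 one has b(x) ≥ C(1 + |x|)^{−μ} for all x, and that sup_{ℝ^m} a₋/b < +∞, where a₋ = max(−a, 0). Let σ > 1 and let u, v be nonnegative C² functions on ℝ^m satisfying Δu + a(x)u − b(x)u^σ ≥ 0 and Δv + a(x)v − b(x)v^σ ≤ 0 on ℝ^m, with liminf_{|x|→∞} v(x) > 0 and limsup_{|x|→∞} u(x) < +∞. Then u ≤ v on ℝ^m. -/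
open MeasureTheory Metric Set Filter

lemma fd_differentiable {m : ℕ} {f : EuclideanSpace ℝ (Fin m) → ℝ} (hf : ContDiff ℝ 2 f)
    (e : EuclideanSpace ℝ (Fin m)) : Differentiable ℝ (fun y => fderiv ℝ f y e) := by
  have h1 : ContDiff ℝ 1 (fderiv ℝ f) := hf.fderiv_right (by norm_num)
  have h2 : Differentiable ℝ (fderiv ℝ f) := h1.differentiable (by norm_num)
  exact fun y => (h2 y).clm_apply (differentiableAt_const e)

lemma lap_sub_smul {m : ℕ} {f g : EuclideanSpace ℝ (Fin m) → ℝ} (hf : ContDiff ℝ 2 f)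
    (hg : ContDiff ℝ 2 g) (t : ℝ) (x : EuclideanSpace ℝ (Fin m)) :
    lap (fun y => f y - t * g y) x = lap f x - t * lap g x := by
  unfold lap
  rw [Finset.mul_sum, ← Finset.sum_sub_distrib]
  refine Finset.sum_congr rfl fun i _ => ?_
  have hfd : Differentiable ℝ f := hf.differentiable (by norm_num)
  have hgd : Differentiable ℝ g := hg.differentiable (by norm_num)
  set e : EuclideanSpace ℝ (Fin m) := EuclideanSpace.single i 1 with he
  have h1 : (fun y => fderiv ℝ (fun y => f y - t * g y) y e)
      = fun y => fderiv ℝ f y e - t * fderiv ℝ g y e := by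
    funext y
    have := ((hfd y).hasFDerivAt.sub ((hgd y).hasFDerivAt.const_mul t)).fderiv
    have h2 : fderiv ℝ (fun y => f y - t * g y) y = fderiv ℝ f y - t • fderiv ℝ g y := this
    rw [h2]; simp
  rw [h1]
  have h3 : fderiv ℝ (fun y => fderiv ℝ f y e - t * fderiv ℝ g y e) x = 
      fderiv ℝ (fun y => fderiv ℝ f y e) x - t • fderiv ℝ (fun y => fderiv ℝ g y e) x :=
    ((fd_differentiable hf e x).hasFDerivAt.sub
      ((fd_differentiable hg e x).hasFDerivAt.const_mul t)).fderiv
  rw [h3]; simp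

lemma lap_nonneg_of_isLocalMin {m : ℕ} {f : EuclideanSpace ℝ (Fin m) → ℝ} (hf : ContDiff ℝ 2 f)
    {x : EuclideanSpace ℝ (Fin m)} (hx : IsLocalMin f x) : 0 ≤ lap f x := by
  unfold lap
  refine Finset.sum_nonneg fun i _ => ?_
  set e : EuclideanSpace ℝ (Fin m) := EuclideanSpace.single i 1 with he
  have hfd : Differentiable ℝ f := hf.differentiable (by norm_num)
  have hl : ∀ t : ℝ, HasDerivAt (fun t : ℝ => x + t • e) e t := fun t => by
    simpa using ((hasDerivAt_id t).smul_const e).const_add x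
  have h1 : ∀ t : ℝ, HasDerivAt (fun t : ℝ => f (x + t • e)) (fderiv ℝ f (x + t • e) e) t :=
    fun t => (hfd _).hasFDerivAt.comp_hasDerivAt t (hl t)
  have h2 : deriv (fun t : ℝ => f (x + t • e)) = fun t => fderiv ℝ f (x + t • e) e :=
    funext fun t => (h1 t).deriv
  have h3 : HasDerivAt (fun t : ℝ => fderiv ℝ f (x + t • e) e)
      (fderiv ℝ (fun y => fderiv ℝ f y e) x e) 0 := by
    have := (fd_differentiable hf e (x + (0:ℝ) • e)).hasFDerivAt.comp_hasDerivAt 0 (hl 0)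
    simpa [Function.comp_def] using this
  have h4 : deriv (deriv (fun t : ℝ => f (x + t • e))) 0
      = fderiv ℝ (fun y => fderiv ℝ f y e) x e := by rw [h2]; exact h3.deriv
  have hmin : IsLocalMin (fun t : ℝ => f (x + t • e)) 0 := by
    have hc : Tendsto (fun t : ℝ => x + t • e) (nhds 0) (nhds x) := by
      have := (hl 0).continuousAt.tendsto
      simpa using this
    have := hc.eventually hx
    show ∀ᶠ t in nhds (0:ℝ), f (x + (0:ℝ) • e) ≤ f (x + t • e)
    simpa using this
  by_contra hneg
  push Not at hneg
  rw [← h4] at hneg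
  have hmax := isLocalMax_of_deriv_deriv_neg hneg hmin.deriv_eq_zero (h1 0).continuousAt
  have hconst : (fun t : ℝ => f (x + t • e)) =ᶠ[nhds 0] fun _ => f (x + (0:ℝ) • e) := by
    filter_upwards [hmin, hmax] with t ha hb
    exact le_antisymm hb ha
  have h5 := hconst.deriv.deriv_eq
  rw [h5] at hneg
  simp at hneg

lemma lap_radial {m : ℕ} (φ φ' φ'' : ℝ → ℝ) (h1 : ∀ s, 0 ≤ s → HasDerivAt φ (φ' s) s)
    (h2 : ∀ s, 0 ≤ s → HasDerivAt φ' (φ'' s) s) (p x : EuclideanSpace ℝ (Fin m)) :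
    lap (fun y => φ (‖y - p‖ ^ 2)) x
      = 4 * φ'' (‖x - p‖ ^ 2) * ‖x - p‖ ^ 2 + 2 * m * φ' (‖x - p‖ ^ 2) := by
  have hn : ∀ y : EuclideanSpace ℝ (Fin m), HasFDerivAt (fun y => ‖y - p‖ ^ 2)
      (2 • (innerSL ℝ (y - p))) y := fun y => by
    simpa using ((hasFDerivAt_id y).sub_const p).norm_sq
  have hv : ∀ (y : EuclideanSpace ℝ (Fin m)) (i : Fin m),
      (2 • (innerSL ℝ (y - p))) (EuclideanSpace.single i (1:ℝ)) = 2 * (y i - p i) := by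
    intro y i
    simp [EuclideanSpace.inner_single_right]
  have hsum : ‖x - p‖ ^ 2 = ∑ i : Fin m, (x i - p i) ^ 2 := by
    rw [EuclideanSpace.norm_sq_eq]; simp
  have key : ∀ i : Fin m, fderiv ℝ (fun y => fderiv ℝ (fun y => φ (‖y - p‖ ^ 2)) y
      (EuclideanSpace.single i 1)) x (EuclideanSpace.single i 1)
      = 4 * φ'' (‖x - p‖ ^ 2) * (x i - p i) ^ 2 + 2 * φ' (‖x - p‖ ^ 2) := by
    intro i
    have ha : (fun y => fderiv ℝ (fun y => φ (‖y - p‖ ^ 2)) y (EuclideanSpace.single i 1))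
        = fun y => φ' (‖y - p‖ ^ 2) * (2 * (y i - p i)) := by
      funext y
      have := ((h1 _ (sq_nonneg ‖y - p‖)).comp_hasFDerivAt y (hn y)).fderiv
      have h' : fderiv ℝ (fun y => φ (‖y - p‖ ^ 2)) y
        = φ' (‖y - p‖ ^ 2) • (2 • (innerSL ℝ (y - p))) := this
      rw [h', ContinuousLinearMap.smul_apply, hv]; simp
    rw [ha]
    have hb := (h2 _ (sq_nonneg ‖x - p‖)).comp_hasFDerivAt x (hn x)
    have hc : HasFDerivAt (fun y : EuclideanSpace ℝ (Fin m) => 2 * (y i - p i))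
        ((2:ℝ) • (EuclideanSpace.proj i : EuclideanSpace ℝ (Fin m) →L[ℝ] ℝ)) x :=
      (((EuclideanSpace.proj i : EuclideanSpace ℝ (Fin m) →L[ℝ] ℝ).hasFDerivAt).sub_const
        (p i)).const_mul 2
    have hd := (hb.mul hc).fderiv
    have he : fderiv ℝ (fun y : EuclideanSpace ℝ (Fin m) => φ' (‖y - p‖ ^ 2) * (2 * (y i - p i))) x
      = _ := hd
    rw [he]
    simp only [ContinuousLinearMap.add_apply, ContinuousLinearMap.smul_apply, hv,
      Function.comp, smul_eq_mul]
    simp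
    ring
  unfold lap
  rw [Finset.sum_congr rfl fun i _ => key i, Finset.sum_add_distrib, ← Finset.mul_sum, ← hsum]
  simp
  ring

lemma strong_pos {m : ℕ} {v c : EuclideanSpace ℝ (Fin m) → ℝ} (hv : ContDiff ℝ 2 v)
    (hc : Continuous c) (hnn : ∀ x, 0 ≤ v x) (hle : ∀ x, lap v x ≤ c x * v x)
    (y : EuclideanSpace ℝ (Fin m)) (hy : 0 < v y) : ∀ x, 0 < v x := by
  by_contra hcon
  push Not at hcon
  obtain ⟨x₀, hx₀⟩ := hcon
  have hZc : IsClosed {x | v x = 0} := isClosed_eq hv.continuous continuous_const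
  obtain ⟨z, hz, hzd⟩ := hZc.exists_infDist_eq_dist ⟨x₀, le_antisymm hx₀ (hnn _)⟩ y
  have hz0 : v z = 0 := hz
  have hnear : ∀ x, v x = 0 → dist y z ≤ dist y x := fun x hx => by
    rw [← hzd]; exact infDist_le_dist_of_mem hx
  have hyz : y ≠ z := by rintro rfl; linarith
  -- the smaller ball touching only at z
  obtain ⟨p, hp⟩ : ∃ p, p = (2:ℝ)⁻¹ • (y + z) := ⟨_, rfl⟩
  obtain ⟨q, hq⟩ : ∃ q, q = (2:ℝ)⁻¹ • (z - y) := ⟨_, rfl⟩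
  have hqz : z - p = q := by rw [hp, hq]; module
  have hqy : p - y = q := by rw [hp, hq]; module
  obtain ⟨R, hR⟩ : ∃ R, R = ‖q‖ := ⟨_, rfl⟩
  have hyzR : dist y z = 2 * R := by
    rw [dist_comm, dist_eq_norm, hR, hq, norm_smul]; norm_num; ring
  have hRpos : 0 < R := by have := dist_pos.2 hyz; linarith
  have honly : ∀ x, ‖x - p‖ ≤ R → v x = 0 → x = z := by
    intro x hx hvx
    have h1 := hnear x hvx
    rw [hyzR, dist_comm, dist_eq_norm] at h1
    have h2 : x - y = (x - p) + q := by rw [← hqy]; abel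
    have h3 : x - z = (x - p) - q := by rw [← hqz]; abel
    have h4 := parallelogram_law_with_norm ℝ (x - p) q
    rw [← h2, ← h3, ← hR] at h4
    have h5 : ‖x - z‖ = 0 := by nlinarith [norm_nonneg (x - z), norm_nonneg (x - p)]
    exact sub_eq_zero.1 (norm_eq_zero.1 h5)
  obtain ⟨ρ, hρ⟩ : ∃ ρ, ρ = R / 2 := ⟨_, rfl⟩
  have hρpos : 0 < ρ := by linarith
  have hK : IsCompact (closedBall z ρ) := isCompact_closedBall z ρ
  obtain ⟨M₀, hM₀⟩ := hK.bddAbove_image hc.continuousOn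
  obtain ⟨M, hM, hMpos⟩ : ∃ M, (∀ x ∈ closedBall z ρ, c x ≤ M) ∧ 0 < M :=
    ⟨max M₀ 1, fun x hx => (hM₀ (mem_image_of_mem c hx)).trans (le_max_left _ _), by positivity⟩
  -- choice of α
  obtain ⟨α, hα, hαbig⟩ : ∃ α > (0:ℝ), ∀ r, ρ ≤ r → M < 4 * α ^ 2 * r ^ 2 - 2 * m * α := by
    refine ⟨(2 * m + M + 1) / (4 * ρ ^ 2) + 1, by positivity, fun r hr => ?_⟩
    set α := (2 * m + M + 1) / (4 * ρ ^ 2) + 1 with hαd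
    have hα1 : 1 ≤ α := by rw [hαd]; have : 0 ≤ (2 * m + M + 1) / (4 * ρ ^ 2) := by positivity
                           linarith
    have h6 : 2 * m + M + 1 ≤ α * (4 * ρ ^ 2) := by
      have : (2 * m + M + 1) / (4 * ρ ^ 2) * (4 * ρ ^ 2) = 2 * m + M + 1 := by field_simp
      rw [hαd, add_mul, this]; nlinarith
    have h7 : ρ ^ 2 ≤ r ^ 2 := by gcongr
    have h8 : 2 * m + M + 1 ≤ α * (4 * r ^ 2) := by nlinarith
    nlinarith
  obtain ⟨h, hh⟩ : ∃ h : EuclideanSpace ℝ (Fin m) → ℝ,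
      h = fun x => (fun s => Real.exp (-α * s) - Real.exp (-α * R ^ 2)) (‖x - p‖ ^ 2) := ⟨_, rfl⟩
  have hhC : ContDiff ℝ 2 h := by
    rw [hh]
    have : ContDiff ℝ 2 (fun x : EuclideanSpace ℝ (Fin m) => ‖x - p‖ ^ 2) :=
      (contDiff_id.sub contDiff_const).norm_sq ℝ
    exact ((contDiff_const.mul this).exp).sub contDiff_const
  have hlap : ∀ x, lap h x = (4 * α ^ 2 * ‖x - p‖ ^ 2 - 2 * m * α) * Real.exp (-α * ‖x - p‖ ^ 2) := by
    intro x
    have hd : ∀ s : ℝ, HasDerivAt (fun s => Real.exp (-α * s)) (-α * Real.exp (-α * s)) s := by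
      intro s
      have := ((hasDerivAt_id s).const_mul (-α)).exp
      simpa [mul_comm] using this
    rw [hh, lap_radial _ (fun s => -α * Real.exp (-α * s)) (fun s => -α * (-α * Real.exp (-α * s)))
      (fun s _ => (hd s).sub_const _) (fun s _ => (hd s).const_mul _)]
    ring
  have hhz : h z = 0 := by rw [hh]; simp [hqz, hR]
  have hhneg : ∀ x, R ≤ ‖x - p‖ → h x ≤ 0 := by
    intro x hx
    rw [hh]
    simp only [sub_nonpos, Real.exp_le_exp]
    have : R ^ 2 ≤ ‖x - p‖ ^ 2 := by gcongr
    nlinarith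
  have hh1 : ∀ x, h x ≤ 1 := by
    intro x
    rw [hh]
    have h9 : Real.exp (-α * ‖x - p‖ ^ 2) ≤ 1 := by
      rw [Real.exp_le_one_iff]; nlinarith [sq_nonneg ‖x - p‖]
    have := Real.exp_pos (-α * R ^ 2)
    simp only; linarith
  -- lower bound on part of the sphere
  obtain ⟨ε, hε, hεv⟩ : ∃ ε > (0:ℝ), ∀ x ∈ sphere z ρ ∩ closedBall p R, ε ≤ v x := by
    have hKc : IsCompact (sphere z ρ ∩ closedBall p R) :=
      (isCompact_sphere z ρ).inter_right isClosed_closedBall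
    rcases (sphere z ρ ∩ closedBall p R).eq_empty_or_nonempty with he | hne
    · exact ⟨1, one_pos, by simp [he]⟩
    · obtain ⟨w, hw, hwmin⟩ := hKc.exists_isMinOn hne hv.continuous.continuousOn
      refine ⟨v w, lt_of_le_of_ne (hnn w) fun h0 => ?_, fun x hx => hwmin hx⟩
      have hwz := honly w (by simpa [dist_eq_norm] using hw.2) h0.symm
      have := hw.1
      rw [hwz] at this
      simp at this
      linarith
  obtain ⟨F, hF⟩ : ∃ F : EuclideanSpace ℝ (Fin m) → ℝ, F = fun x => v x - ε * h x := ⟨_, rfl⟩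
  have hFC : ContDiff ℝ 2 F := by rw [hF]; exact hv.sub (contDiff_const.mul hhC)
  have hFz : F z = 0 := by rw [hF]; simp [hz0, hhz]
  have hFsph : ∀ x ∈ sphere z ρ, 0 ≤ F x := by
    intro x hx
    rw [hF]
    simp only
    by_cases hxR : ‖x - p‖ ≤ R
    · have := hεv x ⟨hx, by simpa [dist_eq_norm] using hxR⟩
      nlinarith [hh1 x]
    · have := hhneg x (le_of_not_ge hxR)
      nlinarith [hnn x]
  obtain ⟨w, hw, hwmin⟩ := hK.exists_isMinOn ⟨z, by simp [hρpos.le]⟩ hFC.continuous.continuousOn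
  have hmain : ∀ w ∈ ball z ρ, IsMinOn F (closedBall z ρ) w → False := by
    intro w hw hwmin
    have hloc : IsLocalMin F w := hwmin.isLocalMin (mem_of_superset (isOpen_ball.mem_nhds hw) ball_subset_closedBall)
    have hL := lap_nonneg_of_isLocalMin hFC hloc
    rw [hF, lap_sub_smul hv hhC, hlap] at hL
    have hFw : F w ≤ 0 := hFz ▸ hwmin (by simp [hρpos.le] : z ∈ closedBall z ρ)
    rw [hF] at hFw
    simp only at hFw
    have hr : ρ ≤ ‖w - p‖ := by
      have h1 : ‖z - p‖ = R := by rw [hqz, hR]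
      have h2 : ‖w - z‖ < ρ := by simpa [dist_eq_norm] using hw
      have h3 := norm_sub_le (w - p) (w - z)
      have h4 : (w - p) - (w - z) = z - p := by abel
      rw [h4] at h3
      linarith
    have h5 := hαbig _ hr
    have hexp := Real.exp_pos (-α * ‖w - p‖ ^ 2)
    have hhle : h w ≤ Real.exp (-α * ‖w - p‖ ^ 2) := by
      rw [hh]; simp only; linarith [Real.exp_pos (-α * R ^ 2)]
    have h6 : lap v w ≤ M * v w := (hle w).trans (mul_le_mul_of_nonneg_right (hM w (ball_subset_closedBall hw)) (hnn w))
    have h7 : M * v w ≤ M * (ε * Real.exp (-α * ‖w - p‖ ^ 2)) := by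
      have := mul_le_mul_of_nonneg_left hhle hε.le
      apply mul_le_mul_of_nonneg_left _ hMpos.le
      linarith
    have h8 := mul_lt_mul_of_pos_right h5 (mul_pos hε hexp)
    nlinarith
  by_cases hwb : w ∈ ball z ρ
  · exact hmain w hwb hwmin
  · have hws : w ∈ sphere z ρ := by
      simp only [mem_ball, not_lt, mem_closedBall, mem_sphere] at *
      exact le_antisymm hw hwb
    refine hmain z (by simp [hρpos]) fun x hx => ?_
    show F z ≤ F x
    rw [hFz]
    exact (hFsph w hws).trans (hwmin hx)

lemma lap_log_le {m : ℕ} (x : EuclideanSpace ℝ (Fin m)) {μ : ℝ} (hμ2 : μ < 2) :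
    lap (fun y : EuclideanSpace ℝ (Fin m) => Real.log (1 + ‖y‖ ^ 2)) x
      ≤ 4 * m * (1 + ‖x‖) ^ (-μ) := by
  have h1 : ∀ s : ℝ, 0 ≤ s → HasDerivAt (fun s => Real.log (1 + s)) ((fun s => (1 + s)⁻¹) s) s := by
    intro s hs
    have := ((hasDerivAt_id s).const_add 1).log (by simp; linarith)
    simpa using this
  have h2 : ∀ s : ℝ, 0 ≤ s → HasDerivAt (fun s : ℝ => (1 + s)⁻¹)
      ((fun s => -1 / (1 + s) ^ 2) s) s := by
    intro s hs
    have := ((hasDerivAt_id s).const_add 1).fun_inv (by simp; linarith)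
    simpa using this
  have h3 := lap_radial _ _ _ h1 h2 (0 : EuclideanSpace ℝ (Fin m)) x
  simp only [sub_zero] at h3
  rw [h3]
  set r := ‖x‖ with hr
  have hr0 : 0 ≤ r := norm_nonneg x
  have h4 : 4 * (-1 / (1 + r ^ 2) ^ 2) * r ^ 2 ≤ 0 := by
    have : 0 ≤ 4 * (1 / (1 + r ^ 2) ^ 2) * r ^ 2 := by positivity
    have e : 4 * (-1 / (1 + r ^ 2) ^ 2) * r ^ 2 = - (4 * (1 / (1 + r ^ 2) ^ 2) * r ^ 2) := by ring
    linarith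
  have h5 : (1 + r ^ 2)⁻¹ ≤ 2 * ((1 + r) ^ 2)⁻¹ := by
    rw [← div_eq_mul_inv, inv_eq_one_div, div_le_div_iff₀ (by positivity) (by positivity)]
    nlinarith [sq_nonneg (r - 1)]
  have h6 : ((1 + r) ^ 2)⁻¹ ≤ (1 + r) ^ (-μ) := by
    have : ((1 + r) ^ 2)⁻¹ = (1 + r) ^ (-2 : ℝ) := by
      rw [Real.rpow_neg (by positivity)]; norm_num
    rw [this]
    exact Real.rpow_le_rpow_of_exponent_le (by linarith) (by linarith)
  have h7 : 2 * (m:ℝ) * (1 + r ^ 2)⁻¹ ≤ 2 * m * (2 * (1 + r) ^ (-μ)) := by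
    gcongr; linarith
  linarith

lemma exists_lower {E : Type*} [TopologicalSpace E] [Nonempty E] {f : E → ℝ} (hf : Continuous f)
    (hpos : ∀ x, 0 < f x) {ε : ℝ} (hε : 0 < ε) (h : ∀ᶠ x in cocompact E, ε ≤ f x) :
    ∃ c > (0:ℝ), ∀ x, c ≤ f x := by
  obtain ⟨K, hK, hKs⟩ := mem_cocompact.1 h
  rcases K.eq_empty_or_nonempty with he | hne
  · exact ⟨ε, hε, fun x => hKs (by simp [he])⟩
  · obtain ⟨w, -, hwmin⟩ := hK.exists_isMinOn hne hf.continuousOn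
    refine ⟨min ε (f w), lt_min hε (hpos w), fun x => ?_⟩
    by_cases hx : x ∈ K
    · exact (min_le_right _ _).trans (hwmin hx)
    · exact (min_le_left _ _).trans (hKs hx)

lemma exists_upper {E : Type*} [TopologicalSpace E] {f : E → ℝ} (hf : Continuous f)
    {M : ℝ} (h : ∀ᶠ x in cocompact E, f x ≤ M) :
    ∃ U > (0:ℝ), ∀ x, f x ≤ U := by
  obtain ⟨K, hK, hKs⟩ := mem_cocompact.1 h
  obtain ⟨B, hB⟩ := hK.bddAbove_image hf.continuousOn
  refine ⟨max 1 (max M B), by positivity, fun x => ?_⟩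
  by_cases hx : x ∈ K
  · exact (hB (mem_image_of_mem f hx)).trans ((le_max_right _ _).trans (le_max_right _ _))
  · have : f x ≤ M := hKs hx
    exact this.trans ((le_max_left _ _).trans (le_max_right _ _))

/-- comparison of sub- and supersolutions under a lower bound on `b`.
The conditions `liminf v > 0` and `limsup u < ∞` at infinity are expressed as eventual
bounds along the cocompact filter. -/
theorem stmt_3 {m : ℕ} (hm : 2 ≤ m) (a b : EuclideanSpace ℝ (Fin m) → ℝ)
    (ha : Continuous a) (hb : Continuous b)
    (C μ : ℝ) (hC : 0 < C) (hμ0 : 0 ≤ μ) (hμ2 : μ < 2)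
    (hblow : ∀ x, C * (1 + ‖x‖) ^ (-μ) ≤ b x)
    (hab : ∃ S : ℝ, ∀ x, max (-a x) 0 / b x ≤ S)
    (σ : ℝ) (hσ : 1 < σ)
    (u v : EuclideanSpace ℝ (Fin m) → ℝ)
    (huC2 : ContDiff ℝ 2 u) (hvC2 : ContDiff ℝ 2 v)
    (hunn : ∀ x, 0 ≤ u x) (hvnn : ∀ x, 0 ≤ v x)
    (husub : ∀ x, 0 ≤ lap u x + a x * u x - b x * u x ^ σ)
    (hvsup : ∀ x, lap v x + a x * v x - b x * v x ^ σ ≤ 0)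
    (hvliminf : ∃ ε > (0:ℝ), ∀ᶠ x in Filter.cocompact (EuclideanSpace ℝ (Fin m)), ε ≤ v x)
    (hulimsup : ∃ M : ℝ, ∀ᶠ x in Filter.cocompact (EuclideanSpace ℝ (Fin m)), u x ≤ M) :
    ∀ x, u x ≤ v x := by
  have hbpos : ∀ x, 0 < b x := fun x =>
    lt_of_lt_of_le (mul_pos hC (Real.rpow_pos_of_pos (by positivity) _)) (hblow x)
  -- positivity of v
  obtain ⟨ε₀, hε₀, hvev⟩ := hvliminf
  have hvpos : ∀ x, 0 < v x := by
    haveI : Nonempty (Fin m) := ⟨⟨0, by omega⟩⟩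
    haveI : (cocompact (EuclideanSpace ℝ (Fin m))).NeBot := by
      infer_instance
    obtain ⟨y, hy⟩ := hvev.exists
    refine strong_pos (c := fun x => - a x + b x * v x ^ (σ - 1)) hvC2 ?_ hvnn ?_ y
      (lt_of_lt_of_le hε₀ hy)
    · exact ha.neg.add (hb.mul (hvC2.continuous.rpow_const fun x => Or.inr (by linarith)))
    · intro x
      have h1 : v x ^ σ = v x ^ (σ - 1) * v x := by
        have h2 := Real.rpow_add_of_nonneg (hvnn x) (by linarith : 0 ≤ σ - 1) zero_le_one
        rw [Real.rpow_one, sub_add_cancel] at h2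
        exact h2
      have h3 := hvsup x
      rw [h1] at h3
      linarith
  obtain ⟨c₀, hc₀, hvc⟩ := exists_lower hvC2.continuous hvpos hε₀ hvev
  obtain ⟨M₁, hM₁⟩ := hulimsup
  obtain ⟨U, hU, huU⟩ := exists_upper huC2.continuous hM₁
  obtain ⟨S, hS⟩ := hab
  obtain ⟨K, hK0, hK⟩ : ∃ K ≥ (0:ℝ), ∀ x, - (K * b x) ≤ a x := by
    refine ⟨max S 0, le_max_right _ _, fun x => ?_⟩
    have h1 := hS x
    rw [div_le_iff₀ (hbpos x)] at h1
    have h2 := mul_le_mul_of_nonneg_right (le_max_left S 0) (hbpos x).le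
    have h3 := le_max_left (-a x) 0
    linarith
  by_contra hcon
  push Not at hcon
  obtain ⟨y, hy⟩ := hcon
  have hbdd : BddAbove (range fun x => u x / v x) := by
    refine ⟨U / c₀, ?_⟩
    rintro _ ⟨x, rfl⟩
    exact div_le_div₀ hU.le (huU x) hc₀ (hvc x)
  obtain ⟨τ, hτ⟩ : ∃ τ, τ = ⨆ x, u x / v x := ⟨_, rfl⟩
  have hτle : ∀ x, u x ≤ τ * v x := fun x => by
    rw [← div_le_iff₀ (hvpos x), hτ]
    exact le_ciSup hbdd x
  have hτ1 : 1 < τ := by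
    have h1 := hτle y
    by_contra h
    push Not at h
    nlinarith [hvpos y]
  obtain ⟨f, hf⟩ : ∃ f : EuclideanSpace ℝ (Fin m) → ℝ, f = fun x => u x - τ * v x := ⟨_, rfl⟩
  have hfC : ContDiff ℝ 2 f := by rw [hf]; exact huC2.sub (contDiff_const.mul hvC2)
  have hfle : ∀ x, f x ≤ 0 := fun x => by rw [hf]; simp only; linarith [hτle x]
  have hfsup : ∀ ε > 0, ∃ x, -ε < f x := by
    intro ε hε
    have h1 : τ - min (ε / U) (τ - 1) < ⨆ x, u x / v x := by
      rw [← hτ]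
      have : 0 < min (ε / U) (τ - 1) := lt_min (by positivity) (by linarith)
      linarith
    obtain ⟨x, hx⟩ := exists_lt_of_lt_ciSup h1
    rw [lt_div_iff₀ (hvpos x)] at hx
    refine ⟨x, ?_⟩
    have h2 : min (ε / U) (τ - 1) ≤ τ - 1 := min_le_right _ _
    have h3 : min (ε / U) (τ - 1) ≤ ε / U := min_le_left _ _
    have hvx := hvpos x
    have h4 : v x < U := by nlinarith [huU x]
    have h5 : ε / U * v x < ε := by
      rw [div_mul_eq_mul_div, div_lt_iff₀ hU]; nlinarith
    rw [hf]; simp only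
    nlinarith
  -- θ
  obtain ⟨θ, hθ0, hθτ, hθσ⟩ : ∃ θ, 0 < θ ∧ θ < τ ∧ τ < θ ^ σ := by
    have hs : (1 + σ) / 2 / σ < 1 := by rw [div_lt_one (by linarith)]; linarith
    refine ⟨τ ^ ((1 + σ) / 2 / σ), Real.rpow_pos_of_pos (by linarith) _, ?_, ?_⟩
    · exact (Real.rpow_lt_rpow_of_exponent_lt hτ1 hs).trans_eq (Real.rpow_one τ)
    · rw [← Real.rpow_mul (by linarith), div_mul_cancel₀ _ (by linarith)]
      exact (Real.rpow_one τ).symm.trans_lt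
        (Real.rpow_lt_rpow_of_exponent_lt hτ1 (by linarith))
  obtain ⟨δ, hδ⟩ : ∃ δ, δ = (θ ^ σ - τ) * c₀ ^ σ / 2 := ⟨_, rfl⟩
  have hδpos : 0 < δ := by
    rw [hδ]
    exact div_pos (mul_pos (by linarith) (Real.rpow_pos_of_pos hc₀ _)) two_pos
  obtain ⟨ε, hε, hεθ, hεK⟩ : ∃ ε > (0:ℝ), ε ≤ c₀ * (τ - θ) ∧ K * ε ≤ δ := by
    refine ⟨min (c₀ * (τ - θ)) (δ / (K + 1)), lt_min (mul_pos hc₀ (by linarith)) (by positivity),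
      min_le_left _ _, ?_⟩
    have h1 := mul_le_mul_of_nonneg_left (min_le_right (c₀ * (τ - θ)) (δ / (K + 1))) hK0
    have h2 : K * (δ / (K + 1)) ≤ δ := by
      rw [mul_div_assoc', div_le_iff₀ (by positivity)]; nlinarith
    exact h1.trans h2
  have hlapf : ∀ x, -ε < f x → δ * b x ≤ lap f x := by
    intro x hx
    have h1 : lap f x = lap u x - τ * lap v x := by rw [hf]; exact lap_sub_smul huC2 hvC2 τ x
    have hfx := hfle x
    have hfe : f x = u x - τ * v x := by rw [hf]
    have h2 : θ * v x ≤ u x := by nlinarith [hvc x]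
    have h3 : θ ^ σ * v x ^ σ ≤ u x ^ σ := by
      rw [← Real.mul_rpow hθ0.le (hvnn x)]
      exact Real.rpow_le_rpow (mul_nonneg hθ0.le (hvnn x)) h2 (by linarith)
    have h4 : c₀ ^ σ ≤ v x ^ σ := Real.rpow_le_rpow hc₀.le (hvc x) (by linarith)
    have h5 : 2 * δ ≤ u x ^ σ - τ * v x ^ σ := by
      have := mul_le_mul_of_nonneg_left h4 (by linarith : 0 ≤ θ ^ σ - τ)
      rw [hδ]; linarith
    have h6 : - (K * b x) * (- f x) ≤ a x * (- f x) :=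
      mul_le_mul_of_nonneg_right (hK x) (by linarith)
    have h7 : K * b x * (- f x) ≤ K * b x * ε :=
      mul_le_mul_of_nonneg_left (by linarith) (mul_nonneg hK0 (hbpos x).le)
    have h8 : b x * (K * ε) ≤ b x * δ := mul_le_mul_of_nonneg_left hεK (hbpos x).le
    have h9 := mul_le_mul_of_nonneg_left h5 (hbpos x).le
    have h10 := husub x
    have h11 := mul_le_mul_of_nonneg_left (hvsup x) (by linarith : 0 ≤ τ)
    rw [h1]
    rw [hfe] at h6 h7
    linarith
  -- the barrier
  obtain ⟨g, hg⟩ : ∃ g : EuclideanSpace ℝ (Fin m) → ℝ, g = fun x => Real.log (1 + ‖x‖ ^ 2) :=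
    ⟨_, rfl⟩
  have hgC : ContDiff ℝ 2 g := by
    rw [hg]
    have : ContDiff ℝ 2 (fun x : EuclideanSpace ℝ (Fin m) => ‖x‖ ^ 2) := contDiff_id.norm_sq ℝ
    exact (contDiff_const.add this).log fun x => by positivity
  have hg0 : ∀ x, 0 ≤ g x := fun x => by
    rw [hg]; exact Real.log_nonneg (by nlinarith [sq_nonneg ‖x‖])
  have hgt : Tendsto g (cocompact _) atTop := by
    rw [hg]
    refine Real.tendsto_log_atTop.comp (tendsto_atTop_add_const_left _ _ ?_)
    exact (tendsto_pow_atTop two_ne_zero).comp (tendsto_norm_cocompact_atTop (E := EuclideanSpace ℝ (Fin m)))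
  obtain ⟨x₀, hx₀⟩ := hfsup (ε / 2) (by linarith)
  obtain ⟨η, hη, hη1, hη2⟩ : ∃ η > (0:ℝ), η * g x₀ < ε / 2 ∧ η * (4 * m) < δ * C := by
    have hgx := hg0 x₀
    refine ⟨min (ε / 2 / (g x₀ + 1)) (δ * C / (4 * m + 1)), lt_min (by positivity) (by positivity),
      ?_, ?_⟩
    · refine lt_of_le_of_lt (mul_le_mul_of_nonneg_right (min_le_left _ _) hgx) ?_
      rw [div_mul_eq_mul_div, div_lt_iff₀ (by positivity)]; nlinarith
    · refine lt_of_le_of_lt (mul_le_mul_of_nonneg_right (min_le_right _ _) (by positivity)) ?_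
      rw [div_mul_eq_mul_div, div_lt_iff₀ (by positivity)]; nlinarith [mul_pos hδpos hC]
  obtain ⟨F, hF⟩ : ∃ F : EuclideanSpace ℝ (Fin m) → ℝ, F = fun x => η * g x - 1 * f x := ⟨_, rfl⟩
  have hgηC : ContDiff ℝ 2 (fun x => η * g x) := contDiff_const.mul hgC
  have hFC : ContDiff ℝ 2 F := by rw [hF]; exact hgηC.sub (contDiff_const.mul hfC)
  have hFt : Tendsto F (cocompact _) atTop := by
    refine tendsto_atTop_mono (fun x => ?_) (hgt.const_mul_atTop hη)
    rw [hF]; simp only; linarith [hfle x]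
  obtain ⟨w, hw⟩ := hFC.continuous.exists_forall_le hFt
  have hL : 0 ≤ lap F w := lap_nonneg_of_isLocalMin hFC (Eventually.of_forall hw)
  have hlapg : lap (fun x => η * g x) w = η * lap g w := by
    have h1 := lap_sub_smul (f := fun _ => (0:ℝ)) contDiff_const hgC (-η) w
    simpa [lap] using h1
  rw [hF, lap_sub_smul hgηC hfC, hlapg] at hL
  have hw0 := hw x₀
  rw [hF] at hw0
  simp only at hw0
  have hfw : -ε < f w := by nlinarith [hg0 w]
  have h1 := hlapf w hfw
  have h2 : lap g w ≤ 4 * m * (1 + ‖w‖) ^ (-μ) := by rw [hg]; exact lap_log_le w hμ2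
  have h3 := mul_le_mul_of_nonneg_left (hblow w) hδpos.le
  have hP : 0 < (1 + ‖w‖) ^ (-μ) := Real.rpow_pos_of_pos (by positivity) _
  have h4 := mul_le_mul_of_nonneg_left h2 hη.le
  have h5 := mul_lt_mul_of_pos_right hη2 hP
  linarith
end

section
/- Existence for a radial boundary value problem: Let m ≥ 2, let A, B ∈ C⁰([0, +∞)) with A ≥ 0 and B > 0 on [0, +∞), let R > 0, let g be a smooth, positive, non-decreasing function on [R, +∞), and let T > 0, σ > 1, α₀ > 0. Then the boundary value problem α'' + (m−1)(g'/g)α' − A(r)α − B(r)α^σ = 0 on (R, R+T), α(R) = α₀, α(R+T) = 0, has a C² solution α on [R, R+T]. Moreover α > 0 and α' < 0 on [R, R+T), and for every T₀ ∈ (0, T] one has |α'(R)| ≤ (g(R+T₀)/g(R))^{m−1} · ( T₀ · max_{s∈[R, R+T₀]} [A(s) + B(s)α₀^{σ−1}] + 1/T₀ ) · α₀. -/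
open Set

lemma hd_lower {f f' : ℝ → ℝ} {a b c : ℝ}
    (hf : ∀ t ∈ Icc a b, HasDerivWithinAt f (f' t) (Icc a b) t)
    (hc : ∀ t ∈ Icc a b, c ≤ f' t) {x y : ℝ} (hx : x ∈ Icc a b) (hy : y ∈ Icc a b)
    (hxy : x ≤ y) : c * (y - x) ≤ f y - f x := by
  have hd : ∀ t ∈ interior (Icc a b), HasDerivAt f (f' t) t := by
    intro t ht
    rw [interior_Icc] at ht
    exact (hf t (Ioo_subset_Icc_self ht)).hasDerivAt (Icc_mem_nhds ht.1 ht.2)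
  refine (convex_Icc a b).mul_sub_le_image_sub_of_le_deriv
    (fun t ht => (hf t ht).continuousWithinAt)
    (fun t ht => (hd t ht).differentiableAt.differentiableWithinAt) ?_ x hx y hy hxy
  intro t ht
  rw [(hd t ht).deriv]
  exact hc t (interior_subset ht)

lemma hd_upper {f f' : ℝ → ℝ} {a b c : ℝ}
    (hf : ∀ t ∈ Icc a b, HasDerivWithinAt f (f' t) (Icc a b) t)
    (hc : ∀ t ∈ Icc a b, f' t ≤ c) {x y : ℝ} (hx : x ∈ Icc a b) (hy : y ∈ Icc a b)
    (hxy : x ≤ y) : f y - f x ≤ c * (y - x) := by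
  have h := hd_lower (f := fun t => - f t) (f' := fun t => - f' t) (c := -c)
    (fun t ht => (hf t ht).neg) (fun t ht => neg_le_neg (hc t ht)) hx hy hxy
  linarith

lemma shooting (a b q₀ Q P α₀ : ℝ) (K : NNReal) (hab : a < b) (hq₀ : 0 < q₀) (hP : 0 ≤ P)
    (hα₀ : 0 < α₀) (q : ℝ → ℝ) (p : ℝ → ℝ → ℝ)
    (hqc : ContinuousOn q (Icc a b)) (hql : ∀ t ∈ Icc a b, q₀ ≤ q t)
    (hqu : ∀ t ∈ Icc a b, q t ≤ Q)
    (hpc : ∀ u, ContinuousOn (fun t => p t u) (Icc a b))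
    (hp0 : ∀ t ∈ Icc a b, ∀ u, 0 ≤ p t u) (hpP : ∀ t ∈ Icc a b, ∀ u, p t u ≤ P)
    (hpz : ∀ t ∈ Icc a b, p t 0 = 0)
    (hpL : ∀ t ∈ Icc a b, LipschitzWith K (p t)) :
    ∃ α v : ℝ → ℝ, (∀ t ∈ Icc a b, HasDerivWithinAt α (q t * v t) (Icc a b) t) ∧
      (∀ t ∈ Icc a b, HasDerivWithinAt v (p t (α t)) (Icc a b) t) ∧
      α a = α₀ ∧ α b = 0 ∧ ∀ t ∈ Icc a b, v t < 0 := by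
  have hT : 0 < b - a := sub_pos.2 hab
  have ha : a ∈ Icc a b := ⟨le_rfl, hab.le⟩
  have hb : b ∈ Icc a b := ⟨hab.le, le_rfl⟩
  have hQ : 0 < Q := hq₀.trans_le ((hql a ha).trans (hqu a ha))
  set S : ℝ := α₀ / (q₀ * (b - a)) with hS
  have hSpos : 0 < S := by positivity
  set M : ℝ := S + P * (b - a) with hM
  have hMpos : 0 < M := by positivity
  let c : ℝ → ℝ := fun v => max (-M) (min v 0)
  have hcL : LipschitzWith 1 c := (LipschitzWith.id.min_const 0).const_max (-M)
  have hc_le : ∀ v, c v ≤ 0 := fun v => max_le (by linarith) (min_le_right _ _)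
  have hc_ge : ∀ v, -M ≤ c v := fun v => le_max_left _ _
  let F : ℝ → ℝ × ℝ → ℝ × ℝ := fun t x => (q t * c x.2, p t x.1)
  have hFL : ∀ t ∈ Icc a b, LipschitzWith (max Q.toNNReal K) (F t) := by
    intro t ht
    have h1 : LipschitzWith (Q.toNNReal) (fun x : ℝ × ℝ => q t * c x.2) := by
      apply LipschitzWith.of_dist_le_mul
      intro x y
      rw [Real.coe_toNNReal _ hQ.le, Real.dist_eq, ← mul_sub, abs_mul,
        abs_of_pos (hq₀.trans_le (hql t ht))]
      apply mul_le_mul (hqu t ht) _ (abs_nonneg _) hQ.le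
      have := hcL.dist_le_mul x.2 y.2
      rw [NNReal.coe_one, one_mul, Real.dist_eq] at this
      exact this.trans (le_max_right _ _)
    have h2 : LipschitzWith K (fun x : ℝ × ℝ => p t x.1) := by
      have := (hpL t ht).comp (LipschitzWith.prod_fst (α := ℝ) (β := ℝ))
      rw [mul_one] at this
      exact this
    exact h1.prodMk h2
  set L : ℝ := max (Q * M) P with hL
  have hL0 : 0 ≤ L := le_max_of_le_right hP
  have hPL : IsPicardLindelof F (tmin := a) (tmax := b) ⟨b, hb⟩ (0 : ℝ × ℝ)
      (S + L * (b - a)).toNNReal S.toNNReal L.toNNReal (max Q.toNNReal K) := by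
    refine ⟨fun t ht => (hFL t ht).lipschitzOnWith, ?_, ?_, ?_⟩
    · intro x _
      exact (hqc.mul continuousOn_const).prodMk (hpc x.1)
    · intro t ht x _
      rw [Real.coe_toNNReal _ hL0, Prod.norm_def]
      apply max_le_max
      · rw [Real.norm_eq_abs, abs_mul, abs_of_pos (hq₀.trans_le (hql t ht))]
        apply mul_le_mul (hqu t ht) _ (abs_nonneg _) hQ.le
        rw [abs_le]
        exact ⟨hc_ge _, (hc_le _).trans hMpos.le⟩
      · rw [Real.norm_eq_abs, abs_of_nonneg (hp0 t ht _)]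
        exact hpP t ht _
    · rw [Real.coe_toNNReal _ hL0, Real.coe_toNNReal _ hSpos.le,
        Real.coe_toNNReal _ (by positivity)]
      simp only [sub_self]
      rw [max_eq_right hT.le]
      linarith
  obtain ⟨Φ, hΦ, L', hΦL⟩ :=
    hPL.exists_forall_mem_closedBall_eq_hasDerivWithinAt_lipschitzOnWith
  have hball : ∀ s ∈ Icc 0 S, ((0 : ℝ), -s) ∈ Metric.closedBall (0 : ℝ × ℝ) S.toNNReal := by
    intro s hs
    rw [mem_closedBall_zero_iff, Real.coe_toNNReal _ hSpos.le, Prod.norm_def]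
    simp only [norm_zero, norm_neg, Real.norm_eq_abs]
    rw [abs_of_nonneg hs.1]
    exact max_le hSpos.le hs.2
  -- properties of each trajectory
  have key : ∀ s ∈ Icc 0 S,
      (∀ t ∈ Icc a b, HasDerivWithinAt (fun t => (Φ (0, -s) t).1)
        (q t * (Φ (0, -s) t).2) (Icc a b) t) ∧
      (∀ t ∈ Icc a b, HasDerivWithinAt (fun t => (Φ (0, -s) t).2)
        (p t (Φ (0, -s) t).1) (Icc a b) t) ∧
      (Φ (0, -s) b) = (0, -s) ∧ ∀ t ∈ Icc a b, (Φ (0, -s) t).2 ≤ -s := by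
    intro s hs
    obtain ⟨h0, hd⟩ := hΦ _ (hball s hs)
    simp only at h0
    have hd2 : ∀ t ∈ Icc a b, HasDerivWithinAt (fun t => (Φ (0, -s) t).2)
        (p t (Φ (0, -s) t).1) (Icc a b) t := fun t ht => (hd t ht).snd
    have hv1 : ∀ t ∈ Icc a b, (Φ (0, -s) t).2 ≤ -s := by
      intro t ht
      have := hd_lower hd2 (fun t ht => hp0 t ht _) ht hb ht.2
      simp only [h0] at this
      linarith
    have hv2 : ∀ t ∈ Icc a b, -M ≤ (Φ (0, -s) t).2 := by
      intro t ht
      have := hd_upper hd2 (fun t ht => hpP t ht _) ht hb ht.2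
      simp only [h0] at this
      have h3 : P * (b - t) ≤ P * (b - a) := mul_le_mul_of_nonneg_left (by linarith [ht.1]) hP
      linarith [hs.2]
    refine ⟨fun t ht => ?_, hd2, h0, hv1⟩
    have h1 := (hd t ht).fst
    have h2 : c (Φ (0, -s) t).2 = (Φ (0, -s) t).2 := by
      simp only [c]
      rw [min_eq_left ((hv1 t ht).trans (by linarith [hs.1])), max_eq_right (hv2 t ht)]
    simp only [F, h2] at h1
    exact h1
  -- intermediate value
  have hcont : ContinuousOn (fun s => (Φ (0, -s) a).1) (Icc 0 S) := by
    apply continuous_fst.comp_continuousOn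
    exact (hΦL a ha).continuousOn.comp (f := fun s : ℝ => ((0 : ℝ), -s))
      (by fun_prop) (fun s hs => hball s hs)
  have hzero : (Φ (0, -0) a).1 = 0 := by
    have h0S : (0 : ℝ) ∈ Icc 0 S := ⟨le_rfl, hSpos.le⟩
    obtain ⟨h0, hd⟩ := hΦ _ (hball 0 h0S)
    have := ODE_solution_unique_of_mem_Icc_left (v := F) (s := fun _ => univ)
      (K := max Q.toNNReal K) (a := a) (b := b) (f := Φ (0, -0)) (g := fun _ => 0)
      (fun t ht => (hFL t (Ioc_subset_Icc_self ht)).lipschitzOnWith)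
      (fun t ht => (hd t ht).continuousWithinAt)
      (fun t ht => (hd t (Ioc_subset_Icc_self ht)).mono_of_mem_nhdsWithin
        (Icc_mem_nhdsLE_of_mem ht))
      (fun t ht => trivial) continuousOn_const
      (fun t ht => by
        have : F t 0 = 0 := by
          simp only [F, c, Prod.snd_zero, Prod.fst_zero, hpz t (Ioc_subset_Icc_self ht)]
          rw [min_self, max_eq_right (by linarith), mul_zero]; rfl
        rw [this]
        exact hasDerivWithinAt_const _ _ _)
      (fun t ht => trivial) (by simpa [Prod.zero_eq_mk] using h0)
    rw [this ha]; rfl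
  have hlarge : α₀ ≤ (Φ (0, -S) a).1 := by
    obtain ⟨h1, h2, h3, h4⟩ := key S ⟨hSpos.le, le_rfl⟩
    have := hd_upper (c := -(q₀ * S)) h1 (fun t ht => by
      have := h4 t ht
      have := hql t ht
      nlinarith) ha hb hab.le
    simp only [h3] at this
    have hh : q₀ * S * (b - a) = α₀ := by rw [hS]; field_simp
    linarith
  obtain ⟨s, hs, hsα⟩ := intermediate_value_Icc hSpos.le hcont
    (show α₀ ∈ Icc _ _ from ⟨by simp only [hzero]; exact hα₀.le, hlarge⟩)
  simp only at hsα
  have hs0 : 0 < s := by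
    rcases hs.1.lt_or_eq with h | h
    · exact h
    · rw [← h, hzero] at hsα
      exact absurd hsα hα₀.ne
  obtain ⟨h1, h2, h3, h4⟩ := key s hs
  exact ⟨_, _, h1, h2, hsα, by simp only [h3], fun t ht => (h4 t ht).trans_lt (by linarith)⟩

theorem stmt_5 {m : ℕ} (hm : 2 ≤ m) (A B : ℝ → ℝ)
    (hA : ContinuousOn A (Set.Ici 0)) (hB : ContinuousOn B (Set.Ici 0))
    (hAnn : ∀ r ∈ Set.Ici (0:ℝ), 0 ≤ A r) (hBpos : ∀ r ∈ Set.Ici (0:ℝ), 0 < B r)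
    (R T σ α₀ : ℝ) (hR : 0 < R) (hT : 0 < T) (hσ : 1 < σ) (hα₀ : 0 < α₀)
    (g : ℝ → ℝ) (hg : ContDiffOn ℝ (⊤ : ℕ∞) g (Set.Ici R))
    (hgpos : ∀ r ∈ Set.Ici R, 0 < g r) (hgmono : MonotoneOn g (Set.Ici R)) :
    ∃ α : ℝ → ℝ, ContDiffOn ℝ 2 α (Set.Icc R (R + T)) ∧
      (∀ r ∈ Set.Ioo R (R + T),
        derivWithin (derivWithin α (Set.Icc R (R + T))) (Set.Icc R (R + T)) r
          + ((m : ℝ) - 1) * (derivWithin g (Set.Ici R) r / g r)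
              * derivWithin α (Set.Icc R (R + T)) r
          - A r * α r - B r * α r ^ σ = 0) ∧
      α R = α₀ ∧ α (R + T) = 0 ∧
      (∀ r ∈ Set.Ico R (R + T), 0 < α r) ∧
      (∀ r ∈ Set.Ico R (R + T), derivWithin α (Set.Icc R (R + T)) r < 0) ∧
      (∀ T₀ ∈ Set.Ioc (0:ℝ) T,
        |derivWithin α (Set.Icc R (R + T)) R| ≤
          (g (R + T₀) / g R) ^ (m - 1) *
            (T₀ * sSup ((fun s => A s + B s * α₀ ^ (σ - 1)) '' Set.Icc R (R + T₀)) + 1 / T₀)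
            * α₀) := by
  have hRE : R < R + T := by linarith
  have hRm : R ∈ Icc R (R + T) := ⟨le_rfl, hRE.le⟩
  have hEm : R + T ∈ Icc R (R + T) := ⟨hRE.le, le_rfl⟩
  have hUD : UniqueDiffOn ℝ (Icc R (R + T)) := uniqueDiffOn_Icc hRE
  have hsub : Icc R (R + T) ⊆ Ici R := Icc_subset_Ici_self
  have hsub0 : Icc R (R + T) ⊆ Ici 0 := fun t ht => hR.le.trans ht.1
  have hAc := hA.mono hsub0
  have hBc := hB.mono hsub0
  have hA0 : ∀ t ∈ Icc R (R + T), 0 ≤ A t := fun t ht => hAnn t (hsub0 ht)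
  have hB0 : ∀ t ∈ Icc R (R + T), 0 ≤ B t := fun t ht => (hBpos t (hsub0 ht)).le
  have hgp : ∀ t ∈ Icc R (R + T), 0 < g t := fun t ht => hgpos t (hsub ht)
  obtain ⟨k, rfl⟩ : ∃ k, m = k + 2 := ⟨m - 2, by omega⟩
  have hgd : ∀ t ∈ Icc R (R + T),
      HasDerivWithinAt g (derivWithin g (Ici R) t) (Icc R (R + T)) t := by
    intro t ht
    have := (hg.differentiableOn (by simp)) t (hsub ht)
    exact this.hasDerivWithinAt.mono hsub
  let w : ℝ → ℝ := fun t => g t ^ (k + 1)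
  have hwp : ∀ t ∈ Icc R (R + T), 0 < w t := fun t ht => pow_pos (hgp t ht) _
  have hwm : ∀ s ∈ Icc R (R + T), ∀ t ∈ Icc R (R + T), s ≤ t → w s ≤ w t := fun s hs t ht h =>
    pow_le_pow_left₀ (hgp s hs).le (hgmono (hsub hs) (hsub ht) h) _
  have hwC : ContDiffOn ℝ 1 w (Icc R (R + T)) :=
    ((hg.mono hsub).of_le (by exact_mod_cast le_top)).pow _
  have hwc : ContinuousOn w (Icc R (R + T)) := hwC.continuousOn
  have hwd : ∀ t ∈ Icc R (R + T), HasDerivWithinAt w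
      ((k + 1 : ℝ) * g t ^ k * derivWithin g (Ici R) t) (Icc R (R + T)) t := by
    intro t ht
    have := (hgd t ht).fun_pow (k + 1)
    simpa using this
  -- truncation
  let c : ℝ → ℝ := fun u => max 0 (min u α₀)
  have hcL : LipschitzWith 1 c := (LipschitzWith.id.min_const α₀).const_max 0
  have hcm : ∀ u, c u ∈ Icc 0 α₀ := fun u =>
    ⟨le_max_left _ _, max_le hα₀.le (min_le_right _ _)⟩
  have hpow : LipschitzOnWith (σ * α₀ ^ (σ - 1)).toNNReal (fun x : ℝ => x ^ σ) (Icc 0 α₀) := by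
    apply (convex_Icc 0 α₀).lipschitzOnWith_of_nnnorm_hasDerivWithin_le
      (fun x hx => (Real.hasDerivAt_rpow_const (Or.inr hσ.le)).hasDerivWithinAt)
    intro x hx
    rw [← NNReal.coe_le_coe, Real.coe_toNNReal _ (by positivity), coe_nnnorm,
      Real.norm_eq_abs, abs_of_nonneg (mul_nonneg (by linarith) (Real.rpow_nonneg hx.1 _))]
    exact mul_le_mul_of_nonneg_left (Real.rpow_le_rpow hx.1 hx.2 (by linarith)) (by linarith)
  set D : ℝ := σ * α₀ ^ (σ - 1) with hD
  have hD0 : 0 ≤ D := by positivity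
  let p : ℝ → ℝ → ℝ := fun t u => w t * (A t * c u + B t * (c u) ^ σ)
  obtain ⟨P, hP⟩ := (isCompact_Icc (a := R) (b := R + T)).bddAbove_image
    (f := fun t => w t * (A t * α₀ + B t * α₀ ^ σ)) (by fun_prop)
  obtain ⟨K, hK⟩ := (isCompact_Icc (a := R) (b := R + T)).bddAbove_image
    (f := fun t => w t * (A t + B t * D)) (by fun_prop)
  have hP' : ∀ t ∈ Icc R (R + T), w t * (A t * α₀ + B t * α₀ ^ σ) ≤ P :=
    fun t ht => hP (mem_image_of_mem _ ht)
  have hK' : ∀ t ∈ Icc R (R + T), w t * (A t + B t * D) ≤ K :=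
    fun t ht => hK (mem_image_of_mem _ ht)
  have hf_le : ∀ t ∈ Icc R (R + T), ∀ x ∈ Icc 0 α₀,
      A t * x + B t * x ^ σ ≤ A t * α₀ + B t * α₀ ^ σ := by
    intro t ht x hx
    exact add_le_add (mul_le_mul_of_nonneg_left hx.2 (hA0 t ht))
      (mul_le_mul_of_nonneg_left (Real.rpow_le_rpow hx.1 hx.2 (by linarith)) (hB0 t ht))
  have hf_nn : ∀ t ∈ Icc R (R + T), ∀ x ∈ Icc 0 α₀, 0 ≤ A t * x + B t * x ^ σ := by
    intro t ht x hx
    exact add_nonneg (mul_nonneg (hA0 t ht) hx.1)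
      (mul_nonneg (hB0 t ht) (Real.rpow_nonneg hx.1 _))
  have hK0 : 0 ≤ K := le_trans (mul_nonneg (hwp R hRm).le
    (add_nonneg (hA0 R hRm) (mul_nonneg (hB0 R hRm) hD0))) (hK' R hRm)
  have hp0 : ∀ t ∈ Icc R (R + T), ∀ u, 0 ≤ p t u := fun t ht u =>
    mul_nonneg (hwp t ht).le (hf_nn t ht _ (hcm u))
  have hpP : ∀ t ∈ Icc R (R + T), ∀ u, p t u ≤ P := fun t ht u =>
    (mul_le_mul_of_nonneg_left (hf_le t ht _ (hcm u)) (hwp t ht).le).trans (hP' t ht)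
  have hpL : ∀ t ∈ Icc R (R + T), LipschitzWith K.toNNReal (p t) := by
    intro t ht
    apply LipschitzWith.of_dist_le_mul
    intro x y
    rw [Real.coe_toNNReal _ hK0]
    have h1 := hcL.dist_le_mul x y
    have h2 := hpow.dist_le_mul (c x) (hcm x) (c y) (hcm y)
    rw [Real.coe_toNNReal _ hD0] at h2
    simp only [Real.dist_eq, NNReal.coe_one, one_mul] at h1 h2 ⊢
    have h3 : p t x - p t y = w t * (A t * (c x - c y) + B t * (c x ^ σ - c y ^ σ)) := by
      simp only [p]; ring
    rw [h3, abs_mul, abs_of_pos (hwp t ht)]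
    have h4 : |A t * (c x - c y) + B t * (c x ^ σ - c y ^ σ)| ≤ (A t + B t * D) * |x - y| := by
      refine (abs_add_le _ _).trans ?_
      rw [abs_mul, abs_mul, abs_of_nonneg (hA0 t ht), abs_of_nonneg (hB0 t ht), add_mul, mul_assoc]
      exact add_le_add (mul_le_mul_of_nonneg_left h1 (hA0 t ht))
        (mul_le_mul_of_nonneg_left (h2.trans (mul_le_mul_of_nonneg_left h1 hD0)) (hB0 t ht))
    refine (mul_le_mul_of_nonneg_left h4 (hwp t ht).le).trans ?_
    rw [← mul_assoc]
    exact mul_le_mul_of_nonneg_right (hK' t ht) (abs_nonneg _)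
  obtain ⟨α, v, hα, hv, hαR, hαE, hvneg⟩ := shooting R (R + T) (w (R + T))⁻¹ (w R)⁻¹ P α₀
    K.toNNReal hRE (inv_pos.2 (hwp _ hEm)) ((hp0 R hRm 0).trans (hpP R hRm 0)) hα₀
    (fun t => (w t)⁻¹) p (hwc.inv₀ fun t ht => (hwp t ht).ne')
    (fun t ht => inv_anti₀ (hwp t ht) (hwm t ht _ hEm ht.2))
    (fun t ht => inv_anti₀ (hwp R hRm) (hwm _ hRm t ht ht.1))
    (fun u => by simp only [p]; fun_prop) hp0 hpP
    (fun t ht => by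
      simp only [p, c]
      rw [min_eq_left hα₀.le, max_self, Real.zero_rpow (by linarith)]; ring) hpL
  have hαanti : StrictAntiOn α (Icc R (R + T)) := by
    refine strictAntiOn_of_hasDerivWithinAt_neg (convex_Icc _ _)
      (fun t ht => (hα t ht).continuousWithinAt)
      (fun t ht => (hα t (interior_subset ht)).mono interior_subset)
      (fun t ht => mul_neg_of_pos_of_neg (inv_pos.2 (hwp t (interior_subset ht)))
        (hvneg t (interior_subset ht)))
  have hαm : ∀ t ∈ Icc R (R + T), α t ∈ Icc 0 α₀ := by
    intro t ht
    constructor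
    · rw [← hαE]; exact hαanti.antitoneOn ht hEm ht.2
    · rw [← hαR]; exact hαanti.antitoneOn hRm ht ht.1
  have hv' : ∀ t ∈ Icc R (R + T), HasDerivWithinAt v
      (w t * (A t * α t + B t * α t ^ σ)) (Icc R (R + T)) t := by
    intro t ht
    have h1 := hv t ht
    have h2 : c (α t) = α t := by
      simp only [c]
      rw [min_eq_left (hαm t ht).2, max_eq_right (hαm t ht).1]
    simp only [p, h2] at h1
    exact h1
  have hαc : ContinuousOn α (Icc R (R + T)) := fun t ht => (hα t ht).continuousWithinAt
  have hdα : ∀ t ∈ Icc R (R + T), derivWithin α (Icc R (R + T)) t = (w t)⁻¹ * v t :=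
    fun t ht => (hα t ht).derivWithin (hUD t ht)
  have hvC : ContDiffOn ℝ 1 v (Icc R (R + T)) := by
    rw [contDiffOn_one_iff_derivWithin hUD]
    refine ⟨fun t ht => (hv' t ht).differentiableWithinAt, ?_⟩
    have h1 : ContinuousOn (fun t => α t ^ σ) (Icc R (R + T)) :=
      hαc.rpow_const (fun t ht => Or.inr (by linarith))
    refine ContinuousOn.congr (f := fun t => w t * (A t * α t + B t * α t ^ σ)) ?_
      (fun t ht => (hv' t ht).derivWithin (hUD t ht))
    fun_prop
  refine ⟨α, ?_, ?_, hαR, hαE, ?_, ?_, ?_⟩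
  · rw [show (2 : WithTop ℕ∞) = 1 + 1 by norm_num, contDiffOn_succ_iff_derivWithin hUD]
    refine ⟨fun t ht => (hα t ht).differentiableWithinAt, by simp, ?_⟩
    exact ((hwC.inv fun t ht => (hwp t ht).ne').mul hvC).congr hdα
  · intro r hr
    have hr' := Ioo_subset_Icc_self hr
    have h1 : HasDerivWithinAt (derivWithin α (Icc R (R + T))) _ (Icc R (R + T)) r :=
      (((hwd r hr').fun_inv (hwp r hr').ne').fun_mul (hv' r hr')).congr hdα (hdα r hr')
    rw [h1.derivWithin (hUD r hr'), hdα r hr']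
    have hg0 := (hgp r hr').ne'
    simp only [w]
    push_cast
    field_simp
    ring
  · intro r hr
    rw [← hαE]
    exact hαanti (Ico_subset_Icc_self hr) hEm hr.2
  · intro r hr
    rw [hdα r (Ico_subset_Icc_self hr)]
    exact mul_neg_of_pos_of_neg (inv_pos.2 (hwp r (Ico_subset_Icc_self hr)))
      (hvneg r (Ico_subset_Icc_self hr))
  · intro T₀ hT₀
    have hT0 : 0 < T₀ := hT₀.1
    have hs1 : Icc R (R + T₀) ⊆ Icc R (R + T) := Icc_subset_Icc_right (by linarith [hT₀.2])
    have hR1 : R ∈ Icc R (R + T₀) := ⟨le_rfl, by linarith⟩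
    have hE1 : R + T₀ ∈ Icc R (R + T₀) := ⟨by linarith, le_rfl⟩
    set Z := sSup ((fun s => A s + B s * α₀ ^ (σ - 1)) '' Set.Icc R (R + T₀)) with hZ
    have hZle : ∀ t ∈ Icc R (R + T₀), A t + B t * α₀ ^ (σ - 1) ≤ Z := by
      intro t ht
      refine le_csSup ?_ (mem_image_of_mem (fun s => A s + B s * α₀ ^ (σ - 1)) ht)
      have hA' := hAc.mono hs1
      have hB' := hBc.mono hs1
      exact isCompact_Icc.bddAbove_image (by fun_prop)
    have hw1 := hwp _ (hs1 hE1)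
    have hwR := hwp _ hRm
    have hα1 : ∀ t ∈ Icc R (R + T₀),
        HasDerivWithinAt α ((w t)⁻¹ * v t) (Icc R (R + T₀)) t :=
      fun t ht => (hα t (hs1 ht)).mono hs1
    have hv1 : ∀ t ∈ Icc R (R + T₀), HasDerivWithinAt v
        (w t * (A t * α t + B t * α t ^ σ)) (Icc R (R + T₀)) t :=
      fun t ht => (hv' t (hs1 ht)).mono hs1
    set C := w (R + T₀) * (Z * α₀) with hC
    have hb : ∀ t ∈ Icc R (R + T₀), w t * (A t * α t + B t * α t ^ σ) ≤ C := by
      intro t ht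
      have h1 := hf_nn t (hs1 ht) _ (hαm t (hs1 ht))
      have h2 := hf_le t (hs1 ht) _ (hαm t (hs1 ht))
      have h3 : α₀ ^ σ = α₀ ^ (σ - 1) * α₀ := by
        rw [Real.rpow_sub_one hα₀.ne']; field_simp
      have h4 : A t * α₀ + B t * α₀ ^ σ ≤ Z * α₀ := by
        rw [h3]
        have := mul_le_mul_of_nonneg_right (hZle t ht) hα₀.le
        linarith
      exact mul_le_mul (hwm t (hs1 ht) _ (hs1 hE1) ht.2) (h2.trans h4) h1 hw1.le
    have hC0 : 0 ≤ C := le_trans (mul_nonneg hwR.le (hf_nn R hRm _ (hαm R hRm))) (hb R hR1)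
    have hvt : ∀ t ∈ Icc R (R + T₀), v t ≤ v R + C * T₀ := by
      intro t ht
      have h1 := hd_upper hv1 hb hR1 ht ht.1
      have h2 : C * (t - R) ≤ C * T₀ := mul_le_mul_of_nonneg_left (by linarith [ht.2]) hC0
      linarith
    have hmain : - v R ≤ C * T₀ + w (R + T₀) * α₀ / T₀ := by
      have hpos : 0 ≤ w (R + T₀) * α₀ / T₀ := by positivity
      rcases le_or_gt 0 (v R + C * T₀) with h | h
      · linarith
      · have h1 := hd_upper (c := (w (R + T₀))⁻¹ * (v R + C * T₀)) hα1 (fun t ht => by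
          have i1 : (w (R + T₀))⁻¹ ≤ (w t)⁻¹ :=
            inv_anti₀ (hwp t (hs1 ht)) (hwm t (hs1 ht) _ (hs1 hE1) ht.2)
          have i2 : 0 < (w t)⁻¹ := inv_pos.2 (hwp t (hs1 ht))
          have i3 := hvt t ht
          nlinarith) hR1 hE1 hE1.1
        have h2 := (hαm _ (hs1 hE1)).1
        rw [hαR] at h1
        have h3 : -α₀ ≤ (w (R + T₀))⁻¹ * (v R + C * T₀) * T₀ := by
          have : R + T₀ - R = T₀ := by ring
          rw [this] at h1
          linarith
        have h4 : -(w (R + T₀) * α₀ / T₀) ≤ v R + C * T₀ := by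
          have h5 := mul_le_mul_of_nonneg_left h3 (div_pos hw1 hT0).le
          have h6 : w (R + T₀) / T₀ * ((w (R + T₀))⁻¹ * (v R + C * T₀) * T₀) = v R + C * T₀ := by
            field_simp
          rw [h6] at h5
          calc _ = w (R + T₀) / T₀ * -α₀ := by ring
            _ ≤ _ := h5
        linarith
    rw [hdα R hRm, abs_mul, abs_of_pos (inv_pos.2 hwR), abs_of_neg (hvneg R hRm)]
    have hwe : (g (R + T₀) / g R) ^ (k + 2 - 1) = (w R)⁻¹ * w (R + T₀) := by
      simp only [w]
      rw [show k + 2 - 1 = k + 1 by omega, div_pow]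
      ring
    rw [hwe]
    refine (mul_le_mul_of_nonneg_left hmain (inv_pos.2 hwR).le).trans (le_of_eq ?_)
    rw [hC]
    ring
end

section
/- A priori monotonicity and derivative estimate for positive solutions of the radial ODE: Let m ≥ 2, let A, B ∈ C⁰([0, +∞)) with A ≥ 0 and B > 0, let R > 0, T > 0, σ > 1, α₀ > 0, and let g be a C¹, positive, non-decreasing function on [R, R+T]. Suppose α is a C² function on [R, R+T] satisfying α'' + (m−1)(g'/g)α' − A(r)α − B(r)α^σ = 0 on (R, R+T) with α > 0 on [R, R+T), α(R) = α₀ and α(R+T) = 0. Then α' < 0 on [R, R+T), and for every T₀ ∈ (0, T] one has |α'(R)| ≤ (g(R+T₀)/g(R))^{m−1} · ( T₀ · max_{s∈[R, R+T₀]} [A(s) + B(s)α₀^{σ−1}] + 1/T₀ ) · α₀. -/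
open Set

/-- a priori monotonicity and derivative estimate for positive solutions
of the radial ODE `α'' + (m−1)(g'/g)α' − A(r)α − B(r)α^σ = 0`.
Derivatives are one-sided derivatives within `[R, R+T]`. -/
theorem stmt_6 {m : ℕ} (hm : 2 ≤ m) (A B : ℝ → ℝ)
    (hA : ContinuousOn A (Set.Ici 0)) (hB : ContinuousOn B (Set.Ici 0))
    (hAnn : ∀ r ∈ Set.Ici (0:ℝ), 0 ≤ A r) (hBpos : ∀ r ∈ Set.Ici (0:ℝ), 0 < B r)
    (R T σ α₀ : ℝ) (hR : 0 < R) (hT : 0 < T) (hσ : 1 < σ) (hα₀ : 0 < α₀)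
    (g : ℝ → ℝ) (hg : ContDiffOn ℝ 1 g (Set.Icc R (R + T)))
    (hgpos : ∀ r ∈ Set.Icc R (R + T), 0 < g r) (hgmono : MonotoneOn g (Set.Icc R (R + T)))
    (α : ℝ → ℝ) (hαC2 : ContDiffOn ℝ 2 α (Set.Icc R (R + T)))
    (hode : ∀ r ∈ Set.Ioo R (R + T),
      derivWithin (derivWithin α (Set.Icc R (R + T))) (Set.Icc R (R + T)) r
        + ((m : ℝ) - 1) * (derivWithin g (Set.Icc R (R + T)) r / g r)
            * derivWithin α (Set.Icc R (R + T)) r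
        - A r * α r - B r * α r ^ σ = 0)
    (hαpos : ∀ r ∈ Set.Ico R (R + T), 0 < α r)
    (hαR : α R = α₀) (hαRT : α (R + T) = 0) :
    (∀ r ∈ Set.Ico R (R + T), derivWithin α (Set.Icc R (R + T)) r < 0) ∧
    (∀ T₀ ∈ Set.Ioc (0:ℝ) T,
      |derivWithin α (Set.Icc R (R + T)) R| ≤
        (g (R + T₀) / g R) ^ (m - 1) *
          (T₀ * sSup ((fun s => A s + B s * α₀ ^ (σ - 1)) '' Set.Icc R (R + T₀)) + 1 / T₀)
          * α₀) := by
  obtain ⟨k, rfl⟩ : ∃ k, m = k + 2 := ⟨m - 2, by omega⟩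
  have hkm : k + 2 - 1 = k + 1 := by omega
  rw [hkm]
  set I := Set.Icc R (R + T) with hI
  have hUD : UniqueDiffOn ℝ I := uniqueDiffOn_Icc (by linarith)
  set β := derivWithin α I with hβ
  have hβC1 : ContDiffOn ℝ 1 β I := hαC2.derivWithin hUD (by norm_num)
  have hdα : ∀ r ∈ Set.Ioo R (R + T), HasDerivAt α (β r) r := by
    intro r hr
    exact ((hαC2.differentiableOn (by norm_num)) r (Set.Ioo_subset_Icc_self hr)).hasDerivWithinAt.hasDerivAt
      (Icc_mem_nhds hr.1 hr.2)
  have hdβ : ∀ r ∈ Set.Ioo R (R + T), HasDerivAt β (derivWithin β I r) r := by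
    intro r hr
    exact ((hβC1.differentiableOn (by norm_num)) r (Set.Ioo_subset_Icc_self hr)).hasDerivWithinAt.hasDerivAt
      (Icc_mem_nhds hr.1 hr.2)
  have hdg : ∀ r ∈ Set.Ioo R (R + T), HasDerivAt g (derivWithin g I r) r := by
    intro r hr
    exact ((hg.differentiableOn (by norm_num)) r (Set.Ioo_subset_Icc_self hr)).hasDerivWithinAt.hasDerivAt
      (Icc_mem_nhds hr.1 hr.2)
  have hdw : ∀ r ∈ Set.Ioo R (R + T), HasDerivAt (fun x => g x ^ (k + 1) * β x)
      (g r ^ (k + 1) * (A r * α r + B r * α r ^ σ)) r := by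
    intro r hr
    have h := ((hdg r hr).fun_pow (k + 1)).fun_mul (hdβ r hr)
    refine h.congr_deriv ?_
    have hgr := hgpos r (Set.Ioo_subset_Icc_self hr)
    have ho : A r * α r + B r * α r ^ σ = derivWithin β I r
        + (((k + 2 : ℕ) : ℝ) - 1) * (derivWithin g I r / g r) * β r := by
      linarith [hode r hr]
    rw [ho]
    have : k + 1 - 1 = k := by omega
    rw [this]
    push_cast
    field_simp
    ring
  have hcα : ContinuousOn α I := hαC2.continuousOn
  have hcβ : ContinuousOn β I := hβC1.continuousOn
  have hcw : ContinuousOn (fun x => g x ^ (k + 1) * β x) I :=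
    (hg.continuousOn.pow _).mul hcβ
  have hwm : StrictMonoOn (fun x => g x ^ (k + 1) * β x) I := by
    refine strictMonoOn_of_deriv_pos (convex_Icc _ _) hcw ?_
    intro r hr
    rw [interior_Icc] at hr
    rw [(hdw r hr).deriv]
    have h0 : r ∈ Set.Ici (0:ℝ) := by
      have := hr.1
      simp only [Set.mem_Ici]; linarith
    have hα := hαpos r ⟨hr.1.le, hr.2⟩
    have h1 := hgpos r (Set.Ioo_subset_Icc_self hr)
    have h2 := hAnn r h0
    have h3 := hBpos r h0
    positivity
  have hneg : ∀ r ∈ Set.Ico R (R + T), β r < 0 := by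
    intro r hr
    by_contra! hc
    have hrI : r ∈ I := ⟨hr.1, hr.2.le⟩
    have hmono : StrictMonoOn α (Set.Icc r (R + T)) := by
      refine strictMonoOn_of_deriv_pos (convex_Icc _ _)
        (hcα.mono (Set.Icc_subset_Icc_left hr.1)) ?_
      intro x hx
      rw [interior_Icc] at hx
      have hxI : x ∈ Set.Ioo R (R + T) := ⟨lt_of_le_of_lt hr.1 hx.1, hx.2⟩
      rw [(hdα x hxI).deriv]
      have h1 := hwm hrI (Set.Ioo_subset_Icc_self hxI) hx.1
      have h2 : 0 ≤ g r ^ (k + 1) * β r := mul_nonneg (pow_nonneg (hgpos r hrI).le _) hc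
      have h3 := pow_pos (hgpos x (Set.Ioo_subset_Icc_self hxI)) (k + 1)
      have h4 : 0 < g x ^ (k + 1) * β x := lt_of_le_of_lt h2 h1
      exact (pos_iff_pos_of_mul_pos h4).1 h3
    have h := hmono (Set.left_mem_Icc.2 hr.2.le) (Set.right_mem_Icc.2 hr.2.le) hr.2
    have := hαpos r hr
    linarith
  refine ⟨hneg, ?_⟩
  intro T₀ hT₀
  obtain ⟨hT0, hTT⟩ := hT₀
  have hanti : StrictAntiOn α I := by
    refine strictAntiOn_of_deriv_neg (convex_Icc _ _) hcα ?_
    intro x hx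
    rw [interior_Icc] at hx
    rw [(hdα x hx).deriv]
    exact hneg x ⟨hx.1.le, hx.2⟩
  have hRI : R ∈ I := ⟨le_rfl, by linarith⟩
  have hR0I : R + T₀ ∈ I := ⟨by linarith, by linarith⟩
  have hsub : Set.Icc R (R + T₀) ⊆ I := Set.Icc_subset_Icc_right (by linarith)
  have hsubo : Set.Ioo R (R + T₀) ⊆ Set.Ioo R (R + T) := Set.Ioo_subset_Ioo_right (by linarith)
  set M := sSup ((fun s => A s + B s * α₀ ^ (σ - 1)) '' Set.Icc R (R + T₀)) with hM
  have hsub0 : Set.Icc R (R + T₀) ⊆ Set.Ici (0:ℝ) := by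
    intro x hx
    have := hx.1
    simp only [Set.mem_Ici]; linarith
  have hbdd : BddAbove ((fun s => A s + B s * α₀ ^ (σ - 1)) '' Set.Icc R (R + T₀)) := by
    refine (isCompact_Icc.image_of_continuousOn ?_).bddAbove
    exact (hA.mono hsub0).add ((hB.mono hsub0).mul continuousOn_const)
  have hMle : ∀ s ∈ Set.Icc R (R + T₀), A s + B s * α₀ ^ (σ - 1) ≤ M := fun s hs =>
    le_csSup hbdd ⟨s, hs, rfl⟩
  obtain ⟨ξ, hξ, hξe⟩ := exists_hasDerivAt_eq_slope α β (by linarith : R < R + T₀)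
    (hcα.mono hsub) (fun x hx => hdα x (hsubo hx))
  have hξξ : Set.Icc R ξ ⊆ I := Set.Icc_subset_Icc_right (by linarith [hξ.2])
  obtain ⟨η, hη, hηe⟩ := exists_hasDerivAt_eq_slope (fun x => g x ^ (k + 1) * β x)
    (fun r => g r ^ (k + 1) * (A r * α r + B r * α r ^ σ)) hξ.1
    (hcw.mono hξξ) (fun x hx => hdw x ⟨hx.1, by linarith [hx.2, hξ.2]⟩)
  have hξI : ξ ∈ I := hsub (Set.Ioo_subset_Icc_self hξ)
  have hη' : η ∈ Set.Ioo R (R + T₀) := ⟨hη.1, hη.2.trans hξ.2⟩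
  have hηI : η ∈ I := hsub (Set.Ioo_subset_Icc_self hη')
  have hη0 := hsub0 (Set.Ioo_subset_Icc_self hη')
  have hαη : 0 < α η := hαpos η ⟨hηI.1, (hsubo hη').2⟩
  have hαη' : α η ≤ α₀ := hαR ▸ (hanti hRI hηI hη.1).le
  have hα1 : 0 ≤ α (R + T₀) := hαRT ▸ hanti.antitoneOn hR0I ⟨by linarith, le_rfl⟩ (by linarith)
  set G := g (R + T₀) ^ (k + 1) with hG
  have hGpos : 0 < G := pow_pos (hgpos _ hR0I) _
  have hgη : g η ^ (k + 1) ≤ G :=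
    pow_le_pow_left₀ (hgpos η hηI).le (hgmono hηI hR0I hη'.2.le) _
  have hgξ : g ξ ^ (k + 1) ≤ G :=
    pow_le_pow_left₀ (hgpos ξ hξI).le (hgmono hξI hR0I hξ.2.le) _
  have hAη := hAnn η hη0
  have hBη := hBpos η hη0
  have hpow : ∀ x : ℝ, 0 < x → x ^ σ = x ^ (σ - 1) * x := by
    intro x hx
    rw [Real.rpow_sub_one hx.ne']
    field_simp
  have hMη := hMle η (Set.Ioo_subset_Icc_self hη')
  have hF : A η * α η + B η * α η ^ σ ≤ M * α₀ := by
    have e1 : A η * α η ≤ A η * α₀ := mul_le_mul_of_nonneg_left hαη' hAη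
    have e2 : α η ^ σ ≤ α₀ ^ σ := Real.rpow_le_rpow hαη.le hαη' (by linarith)
    have e3 : B η * α η ^ σ ≤ B η * α₀ ^ σ := mul_le_mul_of_nonneg_left e2 hBη.le
    have e4 := mul_le_mul_of_nonneg_right hMη hα₀.le
    rw [hpow α₀ hα₀] at e3
    linarith
  have hF0 : 0 ≤ A η * α η + B η * α η ^ σ := by positivity
  have hMα : 0 ≤ M * α₀ := hF0.trans hF
  have hw1 : g η ^ (k + 1) * (A η * α η + B η * α η ^ σ) ≤ G * (M * α₀) :=
    mul_le_mul hgη hF hF0 hGpos.le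
  have hξR : 0 < ξ - R := by linarith [hξ.1]
  have hw2 : g ξ ^ (k + 1) * β ξ - g R ^ (k + 1) * β R ≤ G * (M * α₀) * T₀ := by
    rw [eq_div_iff hξR.ne'] at hηe
    rw [← hηe]
    exact mul_le_mul hw1 (by linarith [hξ.2]) hξR.le (mul_nonneg hGpos.le hMα)
  have hβξ : -β ξ ≤ α₀ / T₀ := by
    rw [hξe, hαR, add_sub_cancel_left, ← neg_div]
    exact div_le_div_of_nonneg_right (by linarith) hT0.le
  have hw3 : g ξ ^ (k + 1) * (-β ξ) ≤ G * (α₀ / T₀) :=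
    mul_le_mul hgξ hβξ (by linarith [hneg ξ ⟨hξI.1, (hsubo hξ).2⟩]) hGpos.le
  have hgR : 0 < g R ^ (k + 1) := pow_pos (hgpos R hRI) _
  rw [abs_of_neg (hneg R ⟨le_rfl, by linarith⟩), div_pow, ← hG]
  have e : G / g R ^ (k + 1) * (T₀ * M + 1 / T₀) * α₀
      = (G * (M * α₀) * T₀ + G * (α₀ / T₀)) / g R ^ (k + 1) := by
    field_simp
  rw [e, le_div_iff₀ hgR]
  linarith
end

section
/- Rayleigh quotient bound from a positive solution of the linear equation: Let a : ℝ^m → ℝ be continuous, μ ∈ ℝ, and let u be a positive C² function on ℝ^m satisfying Δu + μ a(x) u = 0 on ℝ^m. Then for every smooth compactly supported function v : ℝ^m → ℝ one has μ ∫_{ℝ^m} a(x) v(x)² dx ≤ ∫_{ℝ^m} |∇v(x)|² dx. -/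
open MeasureTheory Metric Set Filter

/-- Rayleigh quotient bound from a positive solution of `Δu + μ a u = 0`. -/
theorem stmt_7 {m : ℕ} (a : EuclideanSpace ℝ (Fin m) → ℝ) (ha : Continuous a) (μ : ℝ)
    (u : EuclideanSpace ℝ (Fin m) → ℝ) (huC2 : ContDiff ℝ 2 u) (hupos : ∀ x, 0 < u x)
    (hueq : ∀ x, lap u x + μ * a x * u x = 0) :
    ∀ v : EuclideanSpace ℝ (Fin m) → ℝ, ContDiff ℝ (⊤ : ℕ∞) v → HasCompactSupport v →
      μ * ∫ x, a x * v x ^ 2 ≤ ∫ x, ‖gradient v x‖ ^ 2 := by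
  intro v hv hvc
  set e : Fin m → EuclideanSpace ℝ (Fin m) := fun i => EuclideanSpace.single i 1 with he
  have hu1 : ContDiff ℝ 1 u := huC2.of_le (by norm_num)
  have hv1 : ContDiff ℝ 1 v := hv.of_le (by exact_mod_cast le_top)
  have hud : Differentiable ℝ u := hu1.differentiable (by norm_num)
  have hvd : Differentiable ℝ v := hv1.differentiable (by norm_num)
  have hne : ∀ x, u x ≠ 0 := fun x => (hupos x).ne'
  set w : EuclideanSpace ℝ (Fin m) → ℝ := fun x => v x * (v x * (u x)⁻¹) with hw
  have hwC1 : ContDiff ℝ 1 w := hv1.mul (hv1.mul (hu1.inv hne))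
  have hwc : HasCompactSupport w := hvc.mul_right
  have hwd : Differentiable ℝ w := hwC1.differentiable (by norm_num)
  have hg : ∀ i, ContDiff ℝ 1 (fun y => fderiv ℝ u y (e i)) := fun i =>
    (huC2.fderiv_right (m := 1) (by norm_num)).clm_apply contDiff_const
  have hgd : ∀ i, Differentiable ℝ (fun y => fderiv ℝ u y (e i)) := fun i =>
    (hg i).differentiable (by norm_num)
  have hggc : ∀ i, Continuous (fun x => fderiv ℝ (fun y => fderiv ℝ u y (e i)) x (e i)) := fun i =>
    ((hg i).continuous_fderiv (by norm_num)).clm_apply continuous_const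
  have hwgc : ∀ i, Continuous (fun x => fderiv ℝ w x (e i)) := fun i =>
    (hwC1.continuous_fderiv (by norm_num)).clm_apply continuous_const
  have hwgs : ∀ i, HasCompactSupport (fun x => fderiv ℝ w x (e i)) := fun i =>
    hwc.fderiv_apply ℝ (e i)
  have hvgc : ∀ i, Continuous (fun x => fderiv ℝ v x (e i)) := fun i =>
    (hv1.continuous_fderiv (by norm_num)).clm_apply continuous_const
  have hvgs : ∀ i, HasCompactSupport (fun x => fderiv ℝ v x (e i)) := fun i =>
    hvc.fderiv_apply ℝ (e i)
  have hI1 : ∀ i, Integrable (fun x => fderiv ℝ w x (e i) * fderiv ℝ u x (e i)) := fun i =>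
    ((hwgc i).mul (hg i).continuous).integrable_of_hasCompactSupport (hwgs i).mul_right
  have hI2 : ∀ i, Integrable
      (fun x => w x * fderiv ℝ (fun y => fderiv ℝ u y (e i)) x (e i)) := fun i =>
    (hwC1.continuous.mul (hggc i)).integrable_of_hasCompactSupport hwc.mul_right
  have hI3 : ∀ i, Integrable (fun x => w x * fderiv ℝ u x (e i)) := fun i =>
    (hwC1.continuous.mul (hg i).continuous).integrable_of_hasCompactSupport hwc.mul_right
  have hI4 : ∀ i, Integrable (fun x => fderiv ℝ v x (e i) * fderiv ℝ v x (e i)) := fun i =>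
    ((hvgc i).mul (hvgc i)).integrable_of_hasCompactSupport (hvgs i).mul_right
  have hibp : ∀ i, ∫ x, w x * fderiv ℝ (fun y => fderiv ℝ u y (e i)) x (e i)
      = - ∫ x, fderiv ℝ w x (e i) * fderiv ℝ u x (e i) := fun i =>
    integral_mul_fderiv_eq_neg_fderiv_mul_of_integrable (hI1 i) (hI2 i) (hI3 i) 
      (fun x _ => hwd x) (fun x _ => hgd i x)
  have hfw : ∀ x i, fderiv ℝ w x (e i) = fderiv ℝ v x (e i) * (v x * (u x)⁻¹)
      + v x * (fderiv ℝ v x (e i) * (u x)⁻¹ - v x * (fderiv ℝ u x (e i) * ((u x)⁻¹) ^ 2)) := by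
    intro x i
    have h1 := (hvd x).hasFDerivAt
    have h2 := (hasDerivAt_inv (hne x)).comp_hasFDerivAt x (hud x).hasFDerivAt
    have h3 := h1.mul (h1.mul h2)
    have h4 : HasFDerivAt w _ x := h3
    rw [h4.fderiv]
    simp [pow_two]
    ring
  have hpt : ∀ x i, fderiv ℝ w x (e i) * fderiv ℝ u x (e i)
      ≤ fderiv ℝ v x (e i) * fderiv ℝ v x (e i) := by
    intro x i
    rw [hfw]
    nlinarith [sq_nonneg (fderiv ℝ v x (e i) - v x * (u x)⁻¹ * fderiv ℝ u x (e i))]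
  have hgrad : ∀ x, ‖gradient v x‖ ^ 2 = ∑ i, fderiv ℝ v x (e i) * fderiv ℝ v x (e i) := by
    intro x
    rw [EuclideanSpace.norm_sq_eq]
    refine Finset.sum_congr rfl fun i _ => ?_
    have : fderiv ℝ v x (e i) = gradient v x i := by
      have h := InnerProductSpace.toDual_symm_apply (𝕜 := ℝ) (x := e i) (y := fderiv ℝ v x)
      rw [← h, he, EuclideanSpace.inner_single_right]
      simp [gradient]
    rw [this, Real.norm_eq_abs, sq_abs, pow_two]
  have hlhs : μ * ∫ x, a x * v x ^ 2 = ∑ i, ∫ x, fderiv ℝ w x (e i) * fderiv ℝ u x (e i) := by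
    have h1 : ∀ x, μ * (a x * v x ^ 2)
        = - ∑ i, w x * fderiv ℝ (fun y => fderiv ℝ u y (e i)) x (e i) := by
      intro x
      have h := hueq x
      rw [← Finset.mul_sum]
      change _ = - (w x * lap u x)
      have h' : lap u x = - (μ * a x * u x) := by linarith
      rw [h', hw]
      field_simp [hne x]
    rw [← integral_const_mul]
    simp_rw [h1]
    rw [integral_neg, integral_finsetSum _ (fun i _ => hI2 i), ← Finset.sum_neg_distrib]
    simp_rw [hibp, neg_neg]
  rw [hlhs]
  simp_rw [hgrad]
  rw [integral_finsetSum _ (fun i _ => hI4 i)]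
  exact Finset.sum_le_sum fun i _ => integral_mono (hI1 i) (hI4 i) (fun x => hpt x i)
end

section
/- Spectral positivity from a supersolution with gradient term: Let a : ℝ^m → ℝ be continuous, H > 0 and K ∈ ℝ, and suppose φ is a positive C² function on ℝ^m satisfying Δφ + H a(x) φ ≤ −K |∇φ|²/φ on ℝ^m. Then for every smooth compactly supported function ψ : ℝ^m → ℝ one has ∫_{ℝ^m} ( |∇ψ|² − H a(x) ψ² ) dx ≥ K ∫_{ℝ^m} ψ² |∇φ|²/φ² dx. -/
open MeasureTheory Metric Set Filter

lemma norm_gradient_sq {m : ℕ} (u : EuclideanSpace ℝ (Fin m) → ℝ) (x : EuclideanSpace ℝ (Fin m)) :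
    ‖gradient u x‖ ^ 2 = ∑ i : Fin m, (fderiv ℝ u x (EuclideanSpace.single i 1)) ^ 2 := by
  rw [EuclideanSpace.norm_sq_eq]
  refine Finset.sum_congr rfl fun i _ => ?_
  have h : fderiv ℝ u x (EuclideanSpace.single i 1) = gradient u x i := by
    rw [← InnerProductSpace.toDual_symm_apply (𝕜 := ℝ)]
    rw [EuclideanSpace.inner_single_right]
    simp [gradient]
  rw [h, Real.norm_eq_abs, sq_abs]

lemma integral_fderiv_zero {m : ℕ} (F : EuclideanSpace ℝ (Fin m) → ℝ) (hF : ContDiff ℝ 1 F)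
    (hc : HasCompactSupport F) (e : EuclideanSpace ℝ (Fin m)) :
    Integrable (fun x => fderiv ℝ F x e) ∧ ∫ x, fderiv ℝ F x e = 0 := by
  have hi : Integrable (fun x => fderiv ℝ F x e) :=
    ((hF.continuous_fderiv one_ne_zero).clm_apply continuous_const).integrable_of_hasCompactSupport
      (hc.fderiv_apply ℝ e)
  refine ⟨hi, ?_⟩
  have := integral_mul_fderiv_eq_neg_fderiv_mul_of_integrable (𝕜 := ℝ)
    (f := fun _ : EuclideanSpace ℝ (Fin m) => (1 : ℝ)) (g := F) (v := e) (μ := volume)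
    (by simp) (by simpa using hi)
    (by simpa using hF.continuous.integrable_of_hasCompactSupport hc)
    (by fun_prop) (fun x _ => (hF.differentiable one_ne_zero x))
  simpa using this

/-- spectral positivity from a positive supersolution of
`Δφ + H a φ ≤ −K |∇φ|²/φ`. -/
theorem stmt_8 {m : ℕ} (a : EuclideanSpace ℝ (Fin m) → ℝ) (ha : Continuous a)
    (H K : ℝ) (hH : 0 < H)
    (φ : EuclideanSpace ℝ (Fin m) → ℝ) (hφC2 : ContDiff ℝ 2 φ) (hφpos : ∀ x, 0 < φ x)
    (hφ : ∀ x, lap φ x + H * a x * φ x ≤ -K * ‖gradient φ x‖ ^ 2 / φ x) :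
    ∀ ψ : EuclideanSpace ℝ (Fin m) → ℝ, ContDiff ℝ (⊤ : ℕ∞) ψ → HasCompactSupport ψ →
      K * ∫ x, ψ x ^ 2 * ‖gradient φ x‖ ^ 2 / φ x ^ 2
        ≤ ∫ x, ‖gradient ψ x‖ ^ 2 - H * a x * ψ x ^ 2 := by
  intro ψ hψ hc
  have hne : ∀ x, φ x ≠ 0 := fun x => (hφpos x).ne'
  have hψ1 : ContDiff ℝ 1 ψ := hψ.of_le (by exact_mod_cast le_top)
  have hφ1 : ContDiff ℝ 1 φ := hφC2.of_le (by norm_num)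
  have hD : ∀ i : Fin m, ContDiff ℝ 1 (fun y => fderiv ℝ φ y (EuclideanSpace.single i 1)) :=
    fun i => (hφC2.fderiv_right (m := 1) (by norm_num)).clm_apply contDiff_const
  have hFs : ∀ i : Fin m, ContDiff ℝ 1
      (fun y => ψ y ^ 2 * (fderiv ℝ φ y (EuclideanSpace.single i 1) / φ y)) :=
    fun i => (hψ1.pow 2).mul ((hD i).div hφ1 hne)
  have hFc : ∀ i : Fin m, HasCompactSupport
      (fun y => ψ y ^ 2 * (fderiv ℝ φ y (EuclideanSpace.single i 1) / φ y)) := fun i =>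
    hc.mono' (fun x hx => subset_tsupport _ (fun h => hx (by simp [h])))
  have key := fun i => integral_fderiv_zero _ (hFs i) (hFc i) (EuclideanSpace.single i 1)
  have cg : ∀ u : EuclideanSpace ℝ (Fin m) → ℝ, ContDiff ℝ 1 u → 
      Continuous (fun x => ‖gradient u x‖ ^ 2) := by
    intro u hu
    simp_rw [norm_gradient_sq]
    exact continuous_finsetSum _ fun i _ =>
      ((hu.continuous_fderiv one_ne_zero).clm_apply continuous_const).pow 2
  have hgc : HasCompactSupport (fun x => ‖gradient ψ x‖ ^ 2) := by
    refine (hc.fderiv (𝕜 := ℝ)).mono' (fun x hx => subset_tsupport _ (fun h => hx ?_))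
    simp [gradient, h]
  have i1 : Integrable (fun x => ψ x ^ 2 * ‖gradient φ x‖ ^ 2 / φ x ^ 2) :=
    (((hψ.continuous.pow 2).mul (cg φ hφ1)).div (hφ1.continuous.pow 2)
      (fun x => pow_ne_zero 2 (hne x))).integrable_of_hasCompactSupport
      (hc.mono' (fun x hx => subset_tsupport _ (fun h => hx (by simp [h]))))
  have i2 : Integrable (fun x => ‖gradient ψ x‖ ^ 2 - H * a x * ψ x ^ 2) := by
    refine ((cg ψ hψ1).integrable_of_hasCompactSupport hgc).sub ?_
    exact ((continuous_const.mul ha).mul (hψ.continuous.pow 2)).integrable_of_hasCompactSupport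
      (hc.mono' (fun x hx => subset_tsupport _ (fun h => hx (by simp [h]))))
  have hzero : ∫ x, ∑ i : Fin m, fderiv ℝ
      (fun y => ψ y ^ 2 * (fderiv ℝ φ y (EuclideanSpace.single i 1) / φ y)) x
        (EuclideanSpace.single i 1) = 0 := by
    rw [integral_finsetSum _ fun i _ => (key i).1]
    exact Finset.sum_eq_zero fun i _ => (key i).2
  rw [← integral_const_mul, ← sub_nonneg, ← integral_sub i2 (i1.const_mul K), ← hzero]
  refine integral_mono (integrable_finsetSum _ fun i _ => (key i).1)
    (i2.sub (i1.const_mul K)) fun x => ?_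
  have hcomp : ∀ i : Fin m, fderiv ℝ
      (fun y => ψ y ^ 2 * (fderiv ℝ φ y (EuclideanSpace.single i 1) / φ y)) x
        (EuclideanSpace.single i 1) ≤ (fderiv ℝ ψ x (EuclideanSpace.single i 1)) ^ 2
        + ψ x ^ 2 / φ x * fderiv ℝ (fun y => fderiv ℝ φ y (EuclideanSpace.single i 1)) x
          (EuclideanSpace.single i 1) := by
    intro i
    have d1 := (hψ1.differentiable one_ne_zero x).hasFDerivAt
    have d2 := (hφ1.differentiable one_ne_zero x).hasFDerivAt
    have d3 := ((hD i).differentiable one_ne_zero x).hasFDerivAt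
    have d := (d1.pow 2).mul (d3.mul ((hasDerivAt_inv (hne x)).comp_hasFDerivAt x d2))
    have e : (fun y => ψ y ^ 2 * (fderiv ℝ φ y (EuclideanSpace.single i 1) / φ y))
      = (fun y => ψ y ^ 2 * (fderiv ℝ φ y (EuclideanSpace.single i 1) * (φ y)⁻¹)) := by
      simp only [div_eq_mul_inv]
    rw [e]
    erw [HasFDerivAt.fderiv d]
    simp
    set p := fderiv ℝ ψ x (EuclideanSpace.single i 1)
    set q := fderiv ℝ φ x (EuclideanSpace.single i 1)
    generalize fderiv ℝ (fun y => fderiv ℝ φ y (EuclideanSpace.single i 1)) x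
          (EuclideanSpace.single i 1) = L
    have := sq_nonneg (p - ψ x * q * (φ x)⁻¹)
    rw [div_eq_mul_inv]
    ring_nf at this ⊢
    linarith
  refine (Finset.sum_le_sum fun i _ => hcomp i).trans ?_
  rw [Finset.sum_add_distrib, ← norm_gradient_sq, ← Finset.mul_sum]
  have h := mul_le_mul_of_nonneg_left (hφ x)
    (div_nonneg (sq_nonneg (ψ x)) (hφpos x).le)
  unfold lap at h
  have e1 : ψ x ^ 2 / φ x * (-K * ‖gradient φ x‖ ^ 2 / φ x)
      = - (K * (ψ x ^ 2 * ‖gradient φ x‖ ^ 2 / φ x ^ 2)) := by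
    have := hne x
    field_simp
  have e2 : ψ x ^ 2 / φ x * (H * a x * φ x) = H * a x * ψ x ^ 2 := by
    have := hne x
    field_simp
  rw [mul_add, e1, e2] at h
  linarith
end
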